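/- arXiv:1211.5426 — 2 statements merged into one kernel-verified Lean document; each statement's English description precedes it below -/
import Mathlib

section
/- Let s ∈ (1/2, 1), let x ∈ (0,1) be irrational with regular continued fraction convergent denominators (Q_k)_{k≥0}, and let t ∈ ℝ. If Σ_{k=0}^{∞} Q_{k+1}^{(1−s)/2} / Q_k^{s/2} < ∞, then the series F_s(x,t) = Σ_{k=1}^{∞} e^{iπk²x + 2πikt}/k^s converges (i.e., its partial sums F_{s,n}(x,t) converge as n → ∞). -/
open Complex Filter Finset

noncomputable section

/-- `ρ = e^{iπ/4}`. -/
def ρ : ℂ := Complex.exp (Real.pi * Complex.I / 4)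

/-- Partial sum `F_{s,n}(x,t) = Σ_{k=1}^{n} e^{iπk²x + 2πikt}/k^s`. -/
def Fpart (s : ℝ) (n : ℕ) (x t : ℝ) : ℂ :=
  ∑ k ∈ Finset.Icc 1 n,
    Complex.exp (Real.pi * Complex.I * (k : ℂ) ^ 2 * (x : ℂ)
        + 2 * Real.pi * Complex.I * (k : ℂ) * (t : ℂ)) / (k : ℂ) ^ (s : ℂ)

/-- The function `I_s(x,t)` (for `x > 0`). -/
def Ifun (s x t : ℝ) : ℂ :=
  (∫ u : ℝ, ρ *
      (Complex.exp (Real.pi * Complex.I * ((1 : ℂ) / 2 + ρ * (u : ℂ)) ^ 2 * (x : ℂ)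
            + 2 * Real.pi * Complex.I * ((1 : ℂ) / 2 + ρ * (u : ℂ)) * (Int.fract t : ℝ)) /
        (((1 : ℂ) / 2 + ρ * (u : ℂ)) ^ (s : ℂ) *
          (1 - Complex.exp (2 * Real.pi * Complex.I * ((1 : ℂ) / 2 + ρ * (u : ℂ)))))))
  + ρ * (x : ℂ) ^ (s : ℂ) *
    ∫ u : ℝ, (Real.exp (-(Real.pi * x * u ^ 2)) : ℝ) *
      ∑' k : ℕ, Complex.exp (-(Real.pi * Complex.I * (((k : ℂ) + 1) - (Int.fract t : ℝ)) ^ 2 / (x : ℂ))) *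
        (((ρ * (x : ℂ) * (u : ℂ) + ((k : ℂ) + 1) - (Int.fract t : ℝ)) ^ (s : ℂ))⁻¹
          - (((k : ℂ) + 1) ^ (s : ℂ))⁻¹)

/-- `Ω_s(x,t)`. -/
def Omega (s x t : ℝ) : ℂ :=
  if 0 < x then Ifun s x t else (starRingEnd ℂ) (Ifun s (-x) (-t))

/-- `Ω_s(x) = Ω_s(x,0)`. -/
def Omega0 (s x : ℝ) : ℂ := Omega s x 0

/-- The map `T(x) = -1/x mod 2`, valued in `(-1,1]`. -/
def Tmap (x : ℝ) : ℝ := -1 / x - 2 * ⌈((-1 / x) - 1) / 2⌉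

/-- Denominator `Q_n` of the `n`-th convergent of the regular continued fraction of `x`. -/
def Qden (x : ℝ) (n : ℕ) : ℝ := (GenContFract.of x).dens n

end

open scoped Topology

open GenContFract in
theorem exists_int_contsAux_of (x : ℝ) (n : ℕ) :
    (∃ a b : ℤ, (GenContFract.of x).contsAux n = ⟨(a : ℝ), (b : ℝ)⟩) ∧
      ∃ a b : ℤ, (GenContFract.of x).contsAux (n + 1) = ⟨(a : ℝ), (b : ℝ)⟩ := by
  induction n with
  | zero =>
    refine ⟨⟨1, 0, by simp [GenContFract.contsAux]⟩, ⟨⌊x⌋, 1, ?_⟩⟩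
    simp [GenContFract.contsAux, GenContFract.of_h_eq_floor]
  | succ n ih =>
    refine ⟨ih.2, ?_⟩
    obtain ⟨⟨a, b, h⟩, ⟨a', b', h'⟩⟩ := ih
    cases hg : (GenContFract.of x).s.get? n with
    | none => exact ⟨a', b', by rw [← h']; simp [GenContFract.contsAux, hg]⟩
    | some gp =>
      obtain ⟨h1, z, hz⟩ := of_partNum_eq_one_and_exists_int_partDen_eq hg
      refine ⟨z * a' + a, z * b' + b, ?_⟩
      rw [contsAux_recurrence hg h h', h1, hz]
      push_cast
      simp

open GenContFract in
/-- The convergents of an irrational number: integrality, coprimality, growth of the denominators,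
and two-sided approximation estimates. -/
theorem Irrational.exists_convergents {x : ℝ} (hirr : Irrational x) :
    ∃ (p : ℕ → ℤ) (q : ℕ → ℕ), (∀ n, Qden x n = q n) ∧ q 0 = 1 ∧ Monotone q ∧
      Tendsto q atTop atTop ∧ (∀ n, IsCoprime (p n) (q n)) ∧
      (∀ n, |q n * x - p n| ≤ 1 / q (n + 1)) ∧ ∀ n, 1 / (2 * q (n + 1)) ≤ |q n * x - p n| := by
  have hterm : ∀ n, ¬ (GenContFract.of x).TerminatedAt n := by
    intro n hn
    obtain ⟨r, hr⟩ := exists_rat_eq_of_terminates (v := x) ⟨n, hn⟩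
    exact hirr ⟨r, hr.symm⟩
  have hnn : ∀ n, ∃ (p : ℤ) (q : ℕ), (GenContFract.of x).nums n = p ∧
      (GenContFract.of x).dens n = q := by
    intro n
    obtain ⟨a, b, h⟩ := (exists_int_contsAux_of x n).2
    have hb : (GenContFract.of x).dens n = b := by
      rw [den_eq_conts_b, nth_cont_eq_succ_nth_contAux, h]
    have hb0 : 0 ≤ b := by
      have := zero_le_of_den (v := x) (n := n)
      rw [hb] at this
      exact_mod_cast this
    refine ⟨a, b.toNat, ?_, ?_⟩
    · rw [num_eq_conts_a, nth_cont_eq_succ_nth_contAux, h]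
    · rw [hb]
      exact_mod_cast (Int.toNat_of_nonneg hb0).symm
  choose p q hp hq using hnn
  have hq0 : q 0 = 1 := by
    have := hq 0
    rw [zeroth_den_eq_one] at this
    exact_mod_cast this.symm
  have hmono : Monotone q := by
    refine monotone_nat_of_le_succ fun n => ?_
    have := of_den_mono (v := x) (n := n)
    rw [hq, hq] at this
    exact_mod_cast this
  have hpos : ∀ n, 1 ≤ q n := fun n => hq0 ▸ hmono (Nat.zero_le n)
  have htwo : ∀ n, 2 * q n ≤ q (n + 2) := by
    intro n
    obtain ⟨gp, hgp⟩ := Option.ne_none_iff_exists'.1 (hterm (n + 1))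
    have h1 := (of_partNum_eq_one_and_exists_int_partDen_eq hgp).1
    have h2 : 1 ≤ gp.b := of_one_le_get?_partDen (partDen_eq_s_b hgp)
    have h3 := dens_recurrence hgp (hq n) (hq (n + 1))
    rw [hq, h1] at h3
    have h4 : (q n : ℝ) ≤ q (n + 1) := by exact_mod_cast hmono n.le_succ
    have h5 : (0 : ℝ) ≤ q (n + 1) := Nat.cast_nonneg _
    have : (2 * q n : ℝ) ≤ q (n + 2) := by nlinarith
    exact_mod_cast this
  have htop : Tendsto q atTop atTop := by
    refine tendsto_atTop_atTop_of_monotone hmono fun b => ?_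
    suffices h : ∀ b, b ≤ q (2 * b) from ⟨2 * b, h b⟩
    intro b
    induction b with
    | zero => simp
    | succ b ih =>
      have := htwo (2 * b)
      have := hpos (2 * b)
      rw [show 2 * (b + 1) = 2 * b + 2 by ring]
      omega
  have hdet : ∀ n, p n * q (n + 1) - q n * p (n + 1) = (-1) ^ (n + 1) := by
    intro n
    have h := SimpContFract.determinant (s := SimpContFract.of x) (n := n) (hterm n)
    change (GenContFract.of x).nums n * (GenContFract.of x).dens (n + 1) -
      (GenContFract.of x).dens n * (GenContFract.of x).nums (n + 1) = (-1) ^ (n + 1) at h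
    rw [hp, hp, hq, hq] at h
    exact_mod_cast h
  have hup : ∀ n, |q n * x - p n| ≤ 1 / q (n + 1) := by
    intro n
    have h := abs_sub_convs_le (hterm n)
    rw [conv_eq_num_div_den, hp, hq, hq] at h
    have h1 : (0 : ℝ) < q n := by exact_mod_cast hpos n
    have h2 : (0 : ℝ) < q (n + 1) := by exact_mod_cast hpos (n + 1)
    have h3 : (q n * x - p n : ℝ) = q n * (x - p n / q n) := by field_simp
    rw [h3, abs_mul, abs_of_pos h1]
    calc (q n : ℝ) * |x - p n / q n| ≤ q n * (1 / (q n * q (n + 1))) := by gcongr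
      _ = 1 / q (n + 1) := by field_simp
  refine ⟨p, q, hq, hq0, hmono, htop, fun n => ?_, hup, fun n => ?_⟩
  · have h := hdet n
    have h2 : ((-1 : ℤ) ^ (n + 1)) * (-1) ^ (n + 1) = 1 := by
      rw [← mul_pow]; simp
    refine ⟨(-1) ^ (n + 1) * q (n + 1), -((-1) ^ (n + 1) * p (n + 1)), ?_⟩
    linear_combination ((-1) ^ (n + 1)) * h + h2
  · have h1 : (0 : ℝ) < q n := by exact_mod_cast hpos n
    have h2 : (0 : ℝ) < q (n + 1) := by exact_mod_cast hpos (n + 1)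
    have h3 : (0 : ℝ) < q (n + 2) := by exact_mod_cast hpos (n + 2)
    have h4 : (2 * q n : ℝ) ≤ q (n + 2) := by exact_mod_cast htwo n
    have hd : (p n * q (n + 1) - q n * p (n + 1) : ℝ) = (-1) ^ (n + 1) := by
      exact_mod_cast hdet n
    have h5 : (1 : ℝ) ≤ q (n + 1) * |q n * x - p n| + q n * |q (n + 1) * x - p (n + 1)| := by
      calc (1 : ℝ) = |(-1) ^ (n + 1)| := by simp
        _ = |-(q (n + 1) * (q n * x - p n)) + q n * (q (n + 1) * x - p (n + 1))| := by
            rw [← hd]; congr 1; ring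
        _ ≤ |-(q (n + 1) * (q n * x - p n))| + |q n * (q (n + 1) * x - p (n + 1))| :=
            abs_add_le _ _
        _ = _ := by rw [abs_neg, abs_mul, abs_mul, abs_of_pos h1, abs_of_pos h2]
    have h6 : q n * |q (n + 1) * x - p (n + 1)| ≤ 1 / 2 := by
      calc q n * |q (n + 1) * x - p (n + 1)| ≤ q n * (1 / q (n + 2)) := by
            gcongr; exact hup (n + 1)
        _ = q n / q (n + 2) := by ring
        _ ≤ 1 / 2 := by rw [div_le_div_iff₀ h3 two_pos]; linarith
    rw [div_le_iff₀ (by positivity)]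
    linarith

/-- The phase `e^{iπk²x + 2πikt}`. -/
noncomputable def thetaTerm (x t : ℝ) (k : ℕ) : ℂ :=
  Complex.exp (Real.pi * Complex.I * (k : ℂ) ^ 2 * (x : ℂ)
        + 2 * Real.pi * Complex.I * (k : ℂ) * (t : ℂ))

theorem thetaTerm_eq_exp_ofReal_mul_I (x t : ℝ) (k : ℕ) :
    thetaTerm x t k =
      Complex.exp ((Real.pi * k ^ 2 * x + 2 * Real.pi * k * t : ℝ) * Complex.I) := by
  rw [thetaTerm]
  push_cast
  ring_nf

theorem norm_thetaTerm (x t : ℝ) (k : ℕ) : ‖thetaTerm x t k‖ = 1 := by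
  rw [thetaTerm_eq_exp_ofReal_mul_I, Complex.norm_exp_ofReal_mul_I]

theorem thetaTerm_add (x t : ℝ) (a k : ℕ) :
    thetaTerm x t (a + k) = thetaTerm x t a * thetaTerm x (t + a * x) k := by
  simp only [thetaTerm, ← Complex.exp_add]
  push_cast
  ring_nf

theorem thetaTerm_add_mul_conj (x t : ℝ) (h k : ℕ) :
    thetaTerm x t (h + k) * (starRingEnd ℂ) (thetaTerm x t k) =
      thetaTerm x t h * Complex.exp (2 * Real.pi * (h * x : ℝ) * Complex.I) ^ k := by
  rw [thetaTerm_eq_exp_ofReal_mul_I, thetaTerm_eq_exp_ofReal_mul_I, ← Complex.exp_conj, map_mul,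
    Complex.conj_I, Complex.conj_ofReal, ← Complex.exp_add, thetaTerm_eq_exp_ofReal_mul_I,
    ← Complex.exp_nat_mul, ← Complex.exp_add]
  push_cast
  ring_nf

theorem norm_sum_thetaTerm_shift (x t : ℝ) (a n : ℕ) :
    ‖∑ k ∈ Finset.range n, thetaTerm x t (a + k)‖ =
      ‖∑ k ∈ Finset.range n, thetaTerm x (t + a * x) k‖ := by
  simp only [thetaTerm_add, ← Finset.mul_sum, norm_mul, norm_thetaTerm, one_mul]

theorem normSq_sum_range_eq (f : ℕ → ℂ) (n : ℕ) :
    ‖∑ k ∈ Finset.range n, f k‖ ^ 2 + ∑ k ∈ Finset.range n, ‖f k‖ ^ 2 =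
      2 * (∑ h ∈ Finset.range n, ∑ k ∈ Finset.range (n - h),
        f (h + k) * (starRingEnd ℂ) (f k)).re := by
  have hflip : ∑ h ∈ Finset.range n, ∑ k ∈ Finset.range (n - h), f (h + k) * (starRingEnd ℂ) (f k)
      = ∑ m ∈ Finset.range n, f m * (starRingEnd ℂ) (∑ k ∈ Finset.range (m + 1), f k) := by
    rw [← Finset.sum_range_diag_flip]
    refine Finset.sum_congr rfl fun m _ => ?_
    rw [map_sum, Finset.mul_sum, ← Finset.sum_range_reflect]
    refine Finset.sum_congr rfl fun k hk => ?_
    have : k ≤ m := by simpa [Nat.lt_succ_iff] using hk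
    congr 2
    · omega
    · congr 2; omega
  rw [hflip]
  clear hflip
  induction n with
  | zero => simp
  | succ n ih =>
    rw [Finset.sum_range_succ (fun m => f m * _), Complex.add_re, mul_add, ← ih,
      Finset.sum_range_succ (fun k => ‖f k‖ ^ 2), Finset.sum_range_succ f]
    simp only [← Complex.normSq_eq_norm_sq, Complex.normSq_apply, Complex.add_re, Complex.add_im,
      Complex.mul_re, Complex.conj_re, Complex.conj_im]
    ring

theorem norm_sq_sum_thetaTerm_le (x t : ℝ) (n : ℕ) :
    ‖∑ k ∈ Finset.range n, thetaTerm x t k‖ ^ 2 ≤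
      2 * ∑ h ∈ Finset.range n, ‖∑ k ∈ Finset.range (n - h),
        Complex.exp (2 * Real.pi * (h * x : ℝ) * Complex.I) ^ k‖ := by
  have h1 := normSq_sum_range_eq (thetaTerm x t) n
  have h2 : 0 ≤ ∑ k ∈ Finset.range n, (1 : ℝ) ^ 2 := by positivity
  have h3 := (Complex.re_le_norm _).trans (norm_sum_le (Finset.range n) fun h =>
    ∑ k ∈ Finset.range (n - h), thetaTerm x t (h + k) * (starRingEnd ℂ) (thetaTerm x t k))
  simp only [thetaTerm_add_mul_conj, ← Finset.mul_sum, norm_mul, norm_thetaTerm, one_mul] at h1 h3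
  linarith

theorem norm_geom_sum_exp_le (y : ℝ) (n : ℕ) :
    ‖∑ k ∈ Finset.range n, Complex.exp (2 * Real.pi * y * Complex.I) ^ k‖ ≤ n := by
  refine (norm_sum_le _ _).trans ?_
  have : ‖Complex.exp (2 * Real.pi * y * Complex.I)‖ = 1 := by
    rw [← Complex.norm_exp_ofReal_mul_I (2 * Real.pi * y)]
    push_cast
    rfl
  simp [norm_pow, this]

theorem norm_geom_sum_exp_le_of_dist {y δ : ℝ} (hδ : 0 < δ) (hy : ∀ m : ℤ, δ ≤ |y - m|) (n : ℕ) :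
    ‖∑ k ∈ Finset.range n, Complex.exp (2 * Real.pi * y * Complex.I) ^ k‖ ≤ 1 / (2 * δ) := by
  set z := Complex.exp (2 * Real.pi * y * Complex.I) with hz
  have hz1 : ‖z‖ = 1 := by
    rw [hz, ← Complex.norm_exp_ofReal_mul_I (2 * Real.pi * y)]
    push_cast
    rfl
  set w := y - round y with hw
  have hwδ : δ ≤ |w| := hy (round y)
  have hw2 : |w| ≤ 1 / 2 := abs_sub_round y
  have hzw : z = Complex.exp (Complex.I * (2 * Real.pi * w : ℝ)) := by
    rw [hz, hw, Complex.exp_eq_exp_iff_exists_int]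
    refine ⟨round y, ?_⟩
    push_cast
    ring
  have hsub : 4 * δ ≤ ‖z - 1‖ := by
    rw [hzw, Complex.norm_exp_I_mul_ofReal_sub_one, Real.norm_eq_abs, abs_mul, abs_two]
    have h := Real.mul_abs_le_abs_sin (x := 2 * Real.pi * w / 2) (by
      rw [mul_assoc, mul_div_cancel_left₀ _ two_ne_zero, abs_mul, abs_of_pos Real.pi_pos]
      nlinarith [Real.pi_pos])
    rw [mul_assoc 2 Real.pi w, mul_div_cancel_left₀ _ two_ne_zero, abs_mul,
      abs_of_pos Real.pi_pos, ← mul_assoc, div_mul_cancel₀ _ Real.pi_ne_zero] at h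
    rw [mul_assoc 2 Real.pi w, mul_div_cancel_left₀ _ two_ne_zero]
    linarith
  have hne : z ≠ 1 := by
    rintro h
    rw [h] at hsub
    simp at hsub
    linarith
  rw [geom_sum_eq hne, norm_div]
  have : ‖z ^ n - 1‖ ≤ 2 := by
    refine (norm_sub_le _ _).trans ?_
    rw [norm_pow, hz1]
    norm_num
  calc ‖z ^ n - 1‖ / ‖z - 1‖ ≤ 2 / (4 * δ) := by gcongr
    _ = 1 / (2 * δ) := by field_simp; norm_num

theorem Finset.sum_range_mul_eq {M : Type*} [AddCommMonoid M] (F : ℕ → M) (c q : ℕ) :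
    ∑ h ∈ Finset.range (c * q), F h =
      ∑ b ∈ Finset.range c, ∑ r ∈ Finset.range q, F (b * q + r) := by
  induction c with
  | zero => simp
  | succ c ih => rw [Nat.succ_mul, Finset.sum_range_add, ih, Finset.sum_range_succ]

theorem ZMod.sum_range_natCast {M : Type*} [AddCommMonoid M] (q : ℕ) [NeZero q] (f : ZMod q → M) :
    ∑ r ∈ Finset.range q, f r = ∑ a, f a := by
  refine Finset.sum_bij' (fun r _ => (r : ZMod q)) (fun a _ => a.val) (by simp)
    (fun a _ => by simpa using ZMod.val_lt a) (fun r hr => ?_) (by simp) (by simp)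
  exact ZMod.val_cast_of_lt (by simpa using hr)

theorem ZMod.sum_div_val_le (q : ℕ) [NeZero q] :
    ∑ a : ZMod q, ((q : ℝ) / a.val + q / (-a).val) ≤ 2 * q * (1 + Real.log q) := by
  have h1 : ∑ a : ZMod q, (q : ℝ) / a.val ≤ q * (1 + Real.log q) := by
    rw [← ZMod.sum_range_natCast q fun a => (q : ℝ) / a.val]
    have : ∀ r ∈ Finset.range q, (q : ℝ) / ((r : ZMod q).val : ℝ) = q * (1 / r) := by
      intro r hr
      rw [ZMod.val_cast_of_lt (by simpa using hr), mul_one_div]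
    rw [Finset.sum_congr rfl this, ← Finset.mul_sum]
    gcongr
    obtain ⟨m, hm⟩ : ∃ m, q = m + 1 := Nat.exists_eq_succ_of_ne_zero (NeZero.ne q)
    have h2 := harmonic_le_one_add_log m
    rw [harmonic] at h2
    push_cast at h2
    rw [hm, Finset.sum_range_succ']
    simp only [one_div, Nat.cast_add, Nat.cast_one, Nat.cast_zero, _root_.inv_zero, add_zero]
    refine h2.trans ?_
    rcases Nat.eq_zero_or_pos m with rfl | hm0
    · simp
    · gcongr
      linarith
  have h2 := Equiv.sum_comp (Equiv.neg (ZMod q)) fun a => (q : ℝ) / a.val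
  simp only [Equiv.neg_apply] at h2
  rw [Finset.sum_add_distrib, h2]
  linarith

theorem ZMod.sum_range_mul_unit {M : Type*} [AddCommMonoid M] (q : ℕ) [NeZero q]
    (f : ZMod q → M) {u : ZMod q} (hu : IsUnit u) (b : ℕ) :
    ∑ r ∈ Finset.range q, f (((b * q + r : ℕ) : ZMod q) * u) = ∑ a, f a := by
  obtain ⟨u, rfl⟩ := hu
  rw [← Equiv.sum_comp u.mulRight, ← ZMod.sum_range_natCast]
  simp

theorem sum_one_div_sqrt_le (c : ℕ) :
    ∑ b ∈ Finset.range c, 1 / Real.sqrt (b + 1 : ℝ) ≤ 2 * Real.sqrt c := by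
  induction c with
  | zero => simp
  | succ c ih =>
    rw [Finset.sum_range_succ]
    push_cast
    have h0 : 0 < Real.sqrt (c + 1 : ℝ) := Real.sqrt_pos.2 (by positivity)
    have h1 : Real.sqrt (c + 1 : ℝ) ^ 2 = c + 1 := Real.sq_sqrt (by positivity)
    have h2 : Real.sqrt (c : ℝ) ^ 2 = c := Real.sq_sqrt (by positivity)
    have h3 : 1 / Real.sqrt (c + 1 : ℝ) ≤ 2 * (Real.sqrt (c + 1 : ℝ) - Real.sqrt c) := by
      rw [div_le_iff₀ h0]
      nlinarith [sq_nonneg (Real.sqrt (c + 1 : ℝ) - Real.sqrt c)]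
    linarith

/-- The geometric sum with ratio `e^{2πihx}`, when `h` is not divisible by the denominator `q` of
a good rational approximation of `x`. -/
theorem norm_geom_sum_exp_le_of_not_dvd {x : ℝ} {p : ℤ} {q q' h : ℕ} [NeZero q]
    (hpq : IsCoprime p q) (hup : |q * x - p| ≤ 1 / q') (hh : 2 * h ≤ q') (hq : ¬ q ∣ h) (n : ℕ) :
    ‖∑ k ∈ Finset.range n, Complex.exp (2 * Real.pi * (h * x : ℝ) * Complex.I) ^ k‖ ≤
      q / ((h : ZMod q) * (p : ZMod q)).val + q / (-((h : ZMod q) * (p : ZMod q))).val := by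
  have hq0 : (0 : ℝ) < q := by exact_mod_cast Nat.pos_of_ne_zero (NeZero.ne q)
  have hu : IsUnit (p : ZMod q) := (ZMod.coe_int_isUnit_iff_isCoprime p q).2 hpq.symm
  set a : ZMod q := (h : ZMod q) * (p : ZMod q) with ha
  have ha0 : a ≠ 0 := by
    rw [ha, Ne, hu.mul_left_eq_zero, ZMod.natCast_eq_zero_iff]
    exact hq
  have hv : 0 < a.val := Nat.pos_of_ne_zero ((ZMod.val_ne_zero a).2 ha0)
  have hnv : (-a).val = q - a.val := by
    rw [ZMod.neg_val, if_neg ha0]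
  have hlt : a.val < q := ZMod.val_lt a
  set d : ℕ := min a.val (q - a.val) with hd
  have hd0 : 0 < d := by omega
  have h_dist_int : ∀ m : ℤ, (d : ℤ) ≤ |h * p - m * q| := by
    intro m
    have h1 : ((h * p - m * q : ℤ) : ZMod q) = (a.val : ℤ) := by
      push_cast
      simp [ha]
    rw [ZMod.intCast_eq_intCast_iff_dvd_sub] at h1
    obtain ⟨z, hz⟩ := h1
    have hz' : (h * p - m * q : ℤ) = a.val - q * z := by linarith
    rw [hz', le_abs]
    rcases le_or_gt z 0 with hz0 | hz0
    · left
      have : (q : ℤ) * z ≤ 0 := mul_nonpos_of_nonneg_of_nonpos (by positivity) hz0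
      omega
    · right
      have : (q : ℤ) * 1 ≤ q * z := by gcongr; omega
      omega
  have hdist : ∀ m : ℤ, (d : ℝ) / (2 * q) ≤ |h * x - m| := by
    intro m
    have h1 : (d : ℝ) ≤ |(h * p - m * q : ℝ)| := by exact_mod_cast h_dist_int m
    have h2 : (h : ℝ) * |q * x - p| ≤ 1 / 2 := by
      rcases Nat.eq_zero_or_pos q' with h0 | h0
      · have : h = 0 := by omega
        simp [this]
      · have h0' : (0 : ℝ) < q' := by exact_mod_cast h0
        have hh' : (2 * h : ℝ) ≤ q' := by exact_mod_cast hh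
        calc (h : ℝ) * |q * x - p| ≤ h * (1 / q') := by gcongr
          _ = h / q' := by ring
          _ ≤ 1 / 2 := by rw [div_le_div_iff₀ h0' two_pos]; linarith
    have h3 : |(h * p - m * q : ℝ)| ≤ q * |h * x - m| + h * |q * x - p| := by
      calc |(h * p - m * q : ℝ)| = |q * (h * x - m) - h * (q * x - p)| := by congr 1; ring
        _ ≤ |q * (h * x - m)| + |h * (q * x - p)| := abs_sub _ _
        _ = _ := by rw [abs_mul, abs_mul, abs_of_pos hq0, Nat.abs_cast]
    have h4 : (1 : ℝ) ≤ d := by exact_mod_cast hd0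
    rw [div_le_iff₀ (by positivity)]
    linarith
  have hd0' : (0 : ℝ) < d := by exact_mod_cast hd0
  refine (norm_geom_sum_exp_le_of_dist (by positivity) hdist n).trans ?_
  have h5 : 1 / (2 * ((d : ℝ) / (2 * q))) = q / d := by field_simp
  rw [h5, hnv]
  rcases min_choice a.val (q - a.val) with h6 | h6
  · rw [hd, h6]
    exact le_add_of_nonneg_right (by positivity)
  · rw [hd, h6]
    exact le_add_of_nonneg_left (by positivity)

/-- The geometric sum with ratio `e^{2πihx}`, when `h` is a multiple of the denominator `q` of
a good rational approximation of `x`. -/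
theorem norm_geom_sum_exp_le_of_mul {x : ℝ} {p : ℤ} {q q' b : ℕ} (hq'0 : 0 < q')
    (hup : |q * x - p| ≤ 1 / q') (hlow : 1 / (2 * q') ≤ |q * x - p|)
    (hb : 0 < b) (hh : 2 * b ≤ q') (n : ℕ) :
    ‖∑ k ∈ Finset.range n, Complex.exp (2 * Real.pi * ((b * q : ℕ) * x : ℝ) * Complex.I) ^ k‖ ≤
      q' / b := by
  have hb0 : (0 : ℝ) < b := by exact_mod_cast hb
  have hq0 : (0 : ℝ) < q' := by exact_mod_cast hq'0
  have hdist : ∀ m : ℤ, (b : ℝ) / (2 * q') ≤ |(b * q : ℕ) * x - m| := by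
    intro m
    have h0 : (b : ℝ) * |q * x - p| ≤ 1 / 2 := by
      have hh' : (2 * b : ℝ) ≤ q' := by exact_mod_cast hh
      calc (b : ℝ) * |q * x - p| ≤ b * (1 / q') := by gcongr
        _ = b / q' := by ring
        _ ≤ 1 / 2 := by rw [div_le_div_iff₀ hq0 two_pos]; linarith
    have h1 : (b : ℝ) / (2 * q') ≤ b * |q * x - p| := by
      calc (b : ℝ) / (2 * q') = b * (1 / (2 * q')) := by ring
        _ ≤ _ := by gcongr
    have h2 : ((b * q : ℕ) * x - m : ℝ) = b * (q * x - p) - (m - b * p : ℤ) := by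
      push_cast
      ring
    have h3 : |(b * (q * x - p) : ℝ)| = b * |q * x - p| := by rw [abs_mul, abs_of_pos hb0]
    rw [h2]
    rcases eq_or_ne (m - b * p) 0 with h4 | h4
    · rw [h4, Int.cast_zero, sub_zero, h3]
      exact h1
    · have h5 : (1 : ℝ) ≤ |((m - b * p : ℤ) : ℝ)| := by exact_mod_cast Int.one_le_abs h4
      have h6 := abs_sub_abs_le_abs_sub ((m - b * p : ℤ) : ℝ) (b * (q * x - p))
      rw [abs_sub_comm, h3] at h6
      linarith
  refine (norm_geom_sum_exp_le_of_dist (by positivity) hdist n).trans_eq ?_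
  field_simp

theorem sum_min_sqrt_le {m q q' : ℕ} (hq : 0 < q) :
    ∑ b ∈ Finset.range (m / q), min (m : ℝ) (Real.sqrt (m * (q' / (b + 1 : ℕ)))) ≤
      2 * m * min ((m : ℝ) / q) (Real.sqrt (q' / q)) := by
  have hq0 : (0 : ℝ) < q := by exact_mod_cast hq
  have hdiv : ((m / q : ℕ) : ℝ) ≤ m / q := Nat.cast_div_le
  rw [mul_min_of_nonneg _ _ (by positivity)]
  refine le_min ?_ ?_
  · calc ∑ b ∈ Finset.range (m / q), min (m : ℝ) (Real.sqrt (m * (q' / (b + 1 : ℕ))))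
        ≤ ∑ b ∈ Finset.range (m / q), (m : ℝ) := Finset.sum_le_sum fun _ _ => min_le_left _ _
      _ = (m / q : ℕ) * m := by simp
      _ ≤ m / q * m := by gcongr
      _ ≤ 2 * m * (m / q) := by
        have : (0 : ℝ) ≤ m * (m / q) := by positivity
        linarith
  · calc ∑ b ∈ Finset.range (m / q), min (m : ℝ) (Real.sqrt (m * (q' / (b + 1 : ℕ))))
        ≤ ∑ b ∈ Finset.range (m / q), Real.sqrt (m * q') * (1 / Real.sqrt (b + 1 : ℝ)) := by
          refine Finset.sum_le_sum fun b _ => (min_le_right _ _).trans_eq ?_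
          rw [← mul_div_assoc, Real.sqrt_div' _ (Nat.cast_nonneg _), mul_one_div]
          push_cast
          rfl
      _ ≤ Real.sqrt (m * q') * (2 * Real.sqrt (m / q)) := by
          rw [← Finset.mul_sum]
          gcongr
          exact (sum_one_div_sqrt_le _).trans (by gcongr)
      _ = 2 * m * Real.sqrt (q' / q) := by
          rw [mul_left_comm, ← Real.sqrt_mul (by positivity),
            show (m * q' * (m / q) : ℝ) = m ^ 2 * (q' / q) by ring,
            Real.sqrt_mul (by positivity), Real.sqrt_sq (by positivity), mul_assoc]

theorem norm_sq_sum_thetaTerm_le_of_approx {x : ℝ} {p : ℤ} {q q' m : ℕ} (hq : 0 < q)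
    (hq' : 0 < q') (hpq : IsCoprime p q) (hup : |q * x - p| ≤ 1 / q')
    (hlow : 1 / (2 * q') ≤ |q * x - p|) (hm : 2 * m ≤ q') (t : ℝ) :
    ‖∑ k ∈ Finset.range m, thetaTerm x t k‖ ^ 2 ≤
      4 * (m + q) * (1 + Real.log q) + 2 * m + 4 * m * min ((m : ℝ) / q) (Real.sqrt (q' / q)) := by
  have : NeZero q := ⟨hq.ne'⟩
  have hq0 : (0 : ℝ) < q := by exact_mod_cast hq
  have hlog : 0 ≤ Real.log q := Real.log_natCast_nonneg q
  have hu : IsUnit (p : ZMod q) := (ZMod.coe_int_isUnit_iff_isCoprime p q).2 hpq.symm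
  set u : ZMod q → ℝ := fun a => (q : ℝ) / a.val + q / (-a).val with hu_def
  set v : ℕ → ℝ := fun b => if b = 0 then (m : ℝ) else min (m : ℝ) (Real.sqrt (m * (q' / b)))
    with hv_def
  have hu0 : ∀ a, 0 ≤ u a := fun a => by positivity
  have hv0 : ∀ b, 0 ≤ v b := fun b => by
    simp only [hv_def]
    split_ifs <;> positivity
  set U : ℕ → ℝ := fun h => u ((h : ZMod q) * (p : ZMod q)) + if q ∣ h then v (h / q) else 0
    with hU_def
  have hU0 : ∀ h, 0 ≤ U h := fun h => by
    simp only [hU_def]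
    split_ifs
    · exact add_nonneg (hu0 _) (hv0 _)
    · exact add_nonneg (hu0 _) le_rfl
  have hG : ∀ h ∈ Finset.range m, ‖∑ k ∈ Finset.range (m - h),
      Complex.exp (2 * Real.pi * (h * x : ℝ) * Complex.I) ^ k‖ ≤ U h := by
    intro h hh
    have hhm : h < m := by simpa using hh
    by_cases hd : q ∣ h
    · refine le_trans ?_ (le_add_of_nonneg_left (hu0 _))
      rw [if_pos hd]
      obtain ⟨b, rfl⟩ := hd
      rw [Nat.mul_div_cancel_left b hq]
      have htriv := (norm_geom_sum_exp_le ((q * b : ℕ) * x) (m - q * b)).trans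
        (Nat.cast_le.2 (Nat.sub_le m (q * b)))
      rcases Nat.eq_zero_or_pos b with hb | hb
      · simp [hv_def, hb]
      · have hbq : b ≤ q * b := Nat.le_mul_of_pos_left b hq
        have h1 := norm_geom_sum_exp_le_of_mul hq' hup hlow hb (by omega) (m - q * b)
        rw [mul_comm b q] at h1
        simp only [hv_def, if_neg hb.ne']
        refine le_min htriv (Real.le_sqrt_of_sq_le ?_)
        rw [sq]
        exact mul_le_mul htriv h1 (norm_nonneg _) (Nat.cast_nonneg _)
    · refine le_trans ?_ (le_add_of_nonneg_right (by rw [if_neg hd]))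
      exact norm_geom_sum_exp_le_of_not_dvd hpq hup (by omega) hd (m - h)
  set c := m / q + 1 with hc
  have hcm : m ≤ c * q := by
    rw [hc, mul_comm]
    exact (Nat.lt_mul_div_succ m hq).le
  have hblock : ∀ b, ∑ r ∈ Finset.range q, (if q ∣ b * q + r then v ((b * q + r) / q) else 0)
      = v b := by
    intro b
    rw [Finset.sum_eq_single 0]
    · simp [Nat.mul_div_cancel b hq]
    · intro r hr hr0
      rw [if_neg]
      rw [Nat.dvd_add_right (dvd_mul_left q b)]
      exact Nat.not_dvd_of_pos_of_lt (Nat.pos_of_ne_zero hr0) (by simpa using hr)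
    · intro h
      simp [hq.ne'] at h
  have hsumU : ∑ h ∈ Finset.range (c * q), U h = c * ∑ a, u a + ∑ b ∈ Finset.range c, v b := by
    rw [Finset.sum_range_mul_eq]
    simp only [hU_def, Finset.sum_add_distrib, hblock, ZMod.sum_range_mul_unit q u hu]
    simp
  have hsumv : ∑ b ∈ Finset.range c, v b ≤
      2 * m * min ((m : ℝ) / q) (Real.sqrt (q' / q)) + m := by
    rw [hc, Finset.sum_range_succ']
    have := sum_min_sqrt_le (m := m) (q' := q') hq
    simpa [hv_def] using this
  have hsumu : c * ∑ a, u a ≤ 2 * (m + q) * (1 + Real.log q) := by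
    have h1 : (c : ℝ) ≤ m / q + 1 := by
      rw [hc]
      push_cast
      gcongr
      exact Nat.cast_div_le
    calc c * ∑ a, u a ≤ (m / q + 1) * (2 * q * (1 + Real.log q)) :=
          mul_le_mul h1 (ZMod.sum_div_val_le q) (Finset.sum_nonneg fun a _ => hu0 a)
            (by positivity)
      _ = 2 * (m + q) * (1 + Real.log q) := by field_simp
  have hmain : ∑ h ∈ Finset.range m, ‖∑ k ∈ Finset.range (m - h),
      Complex.exp (2 * Real.pi * (h * x : ℝ) * Complex.I) ^ k‖ ≤
      ∑ h ∈ Finset.range (c * q), U h :=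
    (Finset.sum_le_sum hG).trans (Finset.sum_le_sum_of_subset_of_nonneg
      (Finset.range_mono hcm) fun h _ _ => hU0 h)
  refine (norm_sq_sum_thetaTerm_le x t m).trans ?_
  linarith

/-- A bound, uniform in `t`, for theta sums of length between two consecutive denominators. -/
theorem norm_sum_thetaTerm_le_of_approx {x : ℝ} {p : ℤ} {q q' n : ℕ} (hq : 0 < q)
    (hpq : IsCoprime p q) (hup : |q * x - p| ≤ 1 / q')
    (hlow : 1 / (2 * q') ≤ |q * x - p|) (hqn : q ≤ n) (hn : n < q') (t : ℝ) :
    ‖∑ k ∈ Finset.range n, thetaTerm x t k‖ ≤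
      8 * Real.sqrt (n * (1 + Real.log n)) +
        4 * Real.sqrt (n * min ((n : ℝ) / q) (Real.sqrt (q' / q))) := by
  have hq0 : (0 : ℝ) < q := by exact_mod_cast hq
  have hn1 : (1 : ℝ) ≤ n := by exact_mod_cast (by omega : 1 ≤ n)
  have hlogq : Real.log q ≤ Real.log n := Real.log_le_log hq0 (by exact_mod_cast hqn)
  have hlog : 0 ≤ Real.log q := Real.log_natCast_nonneg q
  have hqn' : (q : ℝ) ≤ n := by exact_mod_cast hqn
  set m := n / 2 with hm
  have hmn : (2 * m : ℝ) ≤ n := by exact_mod_cast (by omega : 2 * m ≤ n)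
  have hm0 : (0 : ℝ) ≤ m := Nat.cast_nonneg m
  set A := (n : ℝ) * (1 + Real.log n) with hA
  set B := n * min ((n : ℝ) / q) (Real.sqrt (q' / q)) with hB
  have hA1 : 1 ≤ A := by
    rw [hA]
    nlinarith
  have hB0 : 0 ≤ B := by positivity
  have hhalf : ∀ t', ‖∑ k ∈ Finset.range m, thetaTerm x t' k‖ ≤ Real.sqrt (7 * A + 2 * B) := by
    intro t'
    refine Real.le_sqrt_of_sq_le ?_
    refine (norm_sq_sum_thetaTerm_le_of_approx hq (by omega) hpq hup hlow (by omega) t').trans ?_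
    have h1 : 4 * (m + q) * (1 + Real.log q) ≤ 6 * A := by
      calc 4 * (m + q) * (1 + Real.log q) ≤ 6 * n * (1 + Real.log n) := by
            gcongr ?_ * (1 + ?_)
            linarith
        _ = 6 * A := by rw [hA]; ring
    have h2 : (4 * m : ℝ) * min ((m : ℝ) / q) (Real.sqrt (q' / q)) ≤ 2 * B := by
      calc (4 * m : ℝ) * min ((m : ℝ) / q) (Real.sqrt (q' / q))
          ≤ (2 * n) * min ((n : ℝ) / q) (Real.sqrt (q' / q)) := by
            gcongr ?_ * min (?_ / _) _
            · linarith
            · linarith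
        _ = 2 * B := by rw [hB]; ring
    have h3 : (n : ℝ) ≤ A := by
      rw [hA]
      nlinarith
    linarith
  have hsplit : ‖∑ k ∈ Finset.range n, thetaTerm x t k‖ ≤ 2 * Real.sqrt (7 * A + 2 * B) + 1 := by
    have h2 : ‖∑ k ∈ Finset.range (m + m), thetaTerm x t k‖ ≤ 2 * Real.sqrt (7 * A + 2 * B) := by
      rw [Finset.sum_range_add]
      refine (norm_add_le _ _).trans ?_
      rw [norm_sum_thetaTerm_shift]
      linarith [hhalf t, hhalf (t + m * x)]
    rcases Nat.even_or_odd' n with ⟨j, hj | hj⟩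
    · have : n = m + m := by omega
      rw [this]
      linarith
    · have : n = m + m + 1 := by omega
      rw [this, Finset.sum_range_succ]
      refine (norm_add_le _ _).trans ?_
      rw [norm_thetaTerm]
      linarith
  have hsA : 1 ≤ Real.sqrt A := Real.one_le_sqrt.2 hA1
  have hle : Real.sqrt (7 * A + 2 * B) ≤ 3 * Real.sqrt A + 2 * Real.sqrt B := by
    refine Real.sqrt_le_iff.2 ⟨by positivity, ?_⟩
    have h1 := Real.sq_sqrt (by linarith : 0 ≤ A)
    have h2 := Real.sq_sqrt hB0
    have h3 : 0 ≤ Real.sqrt A * Real.sqrt B := by positivity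
    nlinarith
  linarith

theorem one_sub_mul_le_rpow_neg {r u : ℝ} (hr : 0 ≤ r) (hu : -1 < u) :
    1 - r * u ≤ (1 + u) ^ (-r) := by
  have h0 : 0 < 1 + u := by linarith
  rw [Real.rpow_def_of_pos h0]
  have h1 := Real.add_one_le_exp (Real.log (1 + u) * -r)
  have h2 := Real.log_le_sub_one_of_pos h0
  have h3 : r * Real.log (1 + u) ≤ r * u := by gcongr; linarith
  linarith

theorem rpow_neg_sub_rpow_neg_succ_le {s : ℝ} (hs0 : 0 ≤ s) (hs1 : s ≤ 1) (n : ℕ) (hn : 0 < n) :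
    (n : ℝ) ^ (-s) - (n + 1 : ℕ) ^ (-s) ≤ (n : ℝ) ^ (-s - 1) := by
  have hn0 : (0 : ℝ) < n := by exact_mod_cast hn
  have h1 := one_sub_mul_le_rpow_neg (r := s) (u := 1 / n) hs0
    (by have : (0 : ℝ) < 1 / n := by positivity
        linarith)
  have h2 : ((n + 1 : ℕ) : ℝ) ^ (-s) = (n : ℝ) ^ (-s) * (1 + 1 / n) ^ (-s) := by
    rw [← Real.mul_rpow (by positivity) (by positivity)]
    congr 1
    push_cast
    field_simp
  rw [h2, Real.rpow_sub_one hn0.ne']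
  have h3 : 0 < (n : ℝ) ^ (-s) := by positivity
  have h4 : (n : ℝ) ^ (-s) * (1 - s * (1 / n)) ≤ (n : ℝ) ^ (-s) * (1 + 1 / n) ^ (-s) := by gcongr
  have h5 : s * ((n : ℝ) ^ (-s) / n) ≤ 1 * ((n : ℝ) ^ (-s) / n) := by gcongr
  have h6 : (n : ℝ) ^ (-s) * (1 - s * (1 / n)) = (n : ℝ) ^ (-s) - s * ((n : ℝ) ^ (-s) / n) := by
    ring
  linarith

theorem sum_rpow_neg_le {s : ℝ} (hs0 : 0 < s) (hs1 : s < 1) (N : ℕ) :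
    ∑ i ∈ Finset.range N, ((i + 1 : ℕ) : ℝ) ^ (-s) ≤ (N : ℝ) ^ (1 - s) / (1 - s) := by
  have h1s : 0 < 1 - s := by linarith
  induction N with
  | zero => simp [Real.zero_rpow h1s.ne']
  | succ n ih =>
    rw [Finset.sum_range_succ]
    have hn0 : (0 : ℝ) < (n + 1 : ℕ) := by positivity
    have h1 := rpow_one_add_le_one_add_mul_self (s := -(1 / ((n + 1 : ℕ) : ℝ))) (p := 1 - s)
      (by rw [neg_le_neg_iff, div_le_one hn0]; push_cast; linarith [Nat.cast_nonneg (α := ℝ) n])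
      h1s.le (by linarith)
    have h2 : (n : ℝ) ^ (1 - s) =
        ((n + 1 : ℕ) : ℝ) ^ (1 - s) * (1 + -(1 / ((n + 1 : ℕ) : ℝ))) ^ (1 - s) := by
      rw [← Real.mul_rpow (by positivity)]
      · congr 1
        push_cast
        field_simp
        ring
      · push_cast
        field_simp
        linarith [Nat.cast_nonneg (α := ℝ) n]
    have h3 : ((n + 1 : ℕ) : ℝ) ^ (-s) = ((n + 1 : ℕ) : ℝ) ^ (1 - s) / (n + 1 : ℕ) := by
      rw [← Real.rpow_sub_one hn0.ne']
      congr 1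
      ring
    have h4 : (n : ℝ) ^ (1 - s) ≤ ((n + 1 : ℕ) : ℝ) ^ (1 - s) *
        (1 + (1 - s) * -(1 / ((n + 1 : ℕ) : ℝ))) := by
      rw [h2]
      gcongr
    have h5 : ((n + 1 : ℕ) : ℝ) ^ (1 - s) * (1 + (1 - s) * -(1 / ((n + 1 : ℕ) : ℝ))) =
        ((n + 1 : ℕ) : ℝ) ^ (1 - s) - (1 - s) * ((n + 1 : ℕ) : ℝ) ^ (-s) := by
      rw [h3]
      ring
    rw [h5] at h4
    rw [le_div_iff₀ h1s] at ih ⊢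
    linarith

theorem sum_Ico_rpow_le {r : ℝ} (hr : 0 < r) {M N : ℕ} (hM : 0 < M) (hMN : M ≤ N) :
    ∑ n ∈ Finset.Ico M N, ((n + 1 : ℕ) : ℝ) ^ (-r - 1) ≤ (M : ℝ) ^ (-r) / r := by
  suffices h : ∑ n ∈ Finset.Ico M N, ((n + 1 : ℕ) : ℝ) ^ (-r - 1) ≤
      ((M : ℝ) ^ (-r) - (N : ℝ) ^ (-r)) / r by
    refine h.trans ?_
    gcongr
    have : 0 ≤ (N : ℝ) ^ (-r) := by positivity
    linarith
  induction N, hMN using Nat.le_induction with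
  | base => simp
  | succ n hn ih =>
    rw [Finset.sum_Ico_succ_top hn]
    have hn0 : (0 : ℝ) < n := by exact_mod_cast (by omega : 0 < n)
    have hn1 : (0 : ℝ) < (n + 1 : ℕ) := by positivity
    have h1 := one_sub_mul_le_rpow_neg (r := r) (u := -(1 / ((n + 1 : ℕ) : ℝ))) hr.le
      (by rw [neg_lt_neg_iff, div_lt_one hn1]; push_cast; linarith)
    have h2 : (n : ℝ) ^ (-r) =
        ((n + 1 : ℕ) : ℝ) ^ (-r) * (1 + -(1 / ((n + 1 : ℕ) : ℝ))) ^ (-r) := by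
      rw [← Real.mul_rpow (by positivity)]
      · congr 1
        push_cast
        field_simp
        ring
      · push_cast
        field_simp
        linarith
    have h4 : ((n + 1 : ℕ) : ℝ) ^ (-r) * (1 - r * -(1 / ((n + 1 : ℕ) : ℝ))) ≤ (n : ℝ) ^ (-r) := by
      rw [h2]
      gcongr
    have h5 : ((n + 1 : ℕ) : ℝ) ^ (-r) * (1 - r * -(1 / ((n + 1 : ℕ) : ℝ))) =
        ((n + 1 : ℕ) : ℝ) ^ (-r) + r * ((n + 1 : ℕ) : ℝ) ^ (-r - 1) := by
      rw [Real.rpow_sub_one hn1.ne']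
      ring
    rw [le_div_iff₀ hr] at ih ⊢
    linarith

section CrossoverBounds

variable {s : ℝ} {q q' : ℕ}

theorem sqrt_mul_min_le_left (hq : 0 < q) (n : ℕ) :
    Real.sqrt (n * min ((n : ℝ) / q) (Real.sqrt (q' / q))) ≤ n * (q : ℝ) ^ (-(1 / 2) : ℝ) := by
  have hq0 : (0 : ℝ) < q := by exact_mod_cast hq
  rw [Real.rpow_neg hq0.le, ← Real.sqrt_eq_rpow]
  refine Real.sqrt_le_iff.2 ⟨by positivity, ?_⟩
  rw [mul_pow, inv_pow, Real.sq_sqrt hq0.le]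
  calc (n : ℝ) * min ((n : ℝ) / q) (Real.sqrt (q' / q)) ≤ n * (n / q) := by
        gcongr; exact min_le_left _ _
    _ = _ := by ring

theorem sqrt_mul_min_le_right (n : ℕ) :
    Real.sqrt (n * min ((n : ℝ) / q) (Real.sqrt (q' / q))) ≤
      (n : ℝ) ^ (1 / 2 : ℝ) * ((q' : ℝ) ^ (1 / 4 : ℝ) * (q : ℝ) ^ (-(1 / 4) : ℝ)) := by
  calc Real.sqrt (n * min ((n : ℝ) / q) (Real.sqrt (q' / q)))
      ≤ Real.sqrt (n * Real.sqrt (q' / q)) := by gcongr; exact min_le_right _ _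
    _ = _ := by
      rw [Real.sqrt_mul (by positivity), Real.sqrt_eq_rpow, Real.sqrt_eq_rpow, Real.sqrt_eq_rpow,
        ← Real.rpow_mul (by positivity), Real.div_rpow (by positivity) (by positivity),
        Real.rpow_neg (by positivity), ← div_eq_mul_inv]
      norm_num

theorem rpow_neg_half_mul_sqrt_rpow (hq : 0 < q) :
    (q : ℝ) ^ (-(1 / 2) : ℝ) * Real.sqrt (q * q') ^ (1 - s) =
      (q' : ℝ) ^ ((1 - s) / 2) / (q : ℝ) ^ (s / 2) := by
  have hq0 : (0 : ℝ) < q := by exact_mod_cast hq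
  rw [Real.sqrt_eq_rpow, ← Real.rpow_mul (by positivity), Real.mul_rpow (by positivity)
    (by positivity), ← mul_assoc, ← Real.rpow_add hq0, div_eq_mul_inv ((q' : ℝ) ^ _),
    ← Real.rpow_neg hq0.le,
    mul_comm]
  ring_nf

theorem rpow_quarter_mul_sqrt_rpow (hq : 0 < q) (hq' : 0 < q') :
    ((q' : ℝ) ^ (1 / 4 : ℝ) * (q : ℝ) ^ (-(1 / 4) : ℝ)) * Real.sqrt (q * q') ^ (-(s - 1 / 2)) =
      (q' : ℝ) ^ ((1 - s) / 2) / (q : ℝ) ^ (s / 2) := by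
  have hq0 : (0 : ℝ) < q := by exact_mod_cast hq
  have hq0' : (0 : ℝ) < q' := by exact_mod_cast hq'
  rw [Real.sqrt_eq_rpow, ← Real.rpow_mul (by positivity), Real.mul_rpow (by positivity)
    (by positivity), mul_comm ((q : ℝ) ^ (_ : ℝ)) ((q' : ℝ) ^ (_ : ℝ)), mul_mul_mul_comm,
    ← Real.rpow_add hq0, ← Real.rpow_add hq0',
    div_eq_mul_inv ((q' : ℝ) ^ _), ← Real.rpow_neg hq0.le]
  ring_nf

theorem sqrt_mul_min_mul_rpow_le (hs1 : 1 / 2 < s) (hs2 : s < 1) (hq : 0 < q) (hq' : 0 < q')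
    {n : ℕ} (hn : 0 < n) :
    Real.sqrt (n * min ((n : ℝ) / q) (Real.sqrt (q' / q))) * (n : ℝ) ^ (-s) ≤
      (q' : ℝ) ^ ((1 - s) / 2) / (q : ℝ) ^ (s / 2) := by
  have hn0 : (0 : ℝ) < n := by exact_mod_cast hn
  have hq0 : (0 : ℝ) < q := by exact_mod_cast hq
  have hq0' : (0 : ℝ) < q' := by exact_mod_cast hq'
  have hN : 0 < Real.sqrt (q * q' : ℝ) := by positivity
  rcases le_total (n : ℝ) (Real.sqrt (q * q')) with h | h
  · rw [← rpow_neg_half_mul_sqrt_rpow hq]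
    calc _ ≤ n * (q : ℝ) ^ (-(1 / 2) : ℝ) * (n : ℝ) ^ (-s) := by
          gcongr; exact sqrt_mul_min_le_left hq n
      _ = (q : ℝ) ^ (-(1 / 2) : ℝ) * (n : ℝ) ^ (1 - s) := by
          rw [Real.rpow_sub hn0, Real.rpow_neg hn0.le, Real.rpow_one]
          ring
      _ ≤ _ := by gcongr
  · rw [← rpow_quarter_mul_sqrt_rpow hq hq']
    calc _ ≤ (n : ℝ) ^ (1 / 2 : ℝ) * ((q' : ℝ) ^ (1 / 4 : ℝ) * (q : ℝ) ^ (-(1 / 4) : ℝ)) *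
          (n : ℝ) ^ (-s) := by
          gcongr; exact sqrt_mul_min_le_right n
      _ = ((q' : ℝ) ^ (1 / 4 : ℝ) * (q : ℝ) ^ (-(1 / 4) : ℝ)) * (n : ℝ) ^ (-(s - 1 / 2)) := by
          rw [show -(s - 1 / 2) = 1 / 2 + -s by ring, Real.rpow_add hn0]
          ring
      _ ≤ _ := by
          gcongr ?_ * ?_
          exact Real.rpow_le_rpow_of_nonpos hN h (by linarith)

theorem sum_Ico_sqrt_mul_min_mul_rpow_le (hs1 : 1 / 2 < s) (hs2 : s < 1) (hq : 0 < q)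
    (hqq' : q ≤ q') :
    ∑ n ∈ Finset.Ico q q',
        Real.sqrt (n * min ((n : ℝ) / q) (Real.sqrt (q' / q))) * (n : ℝ) ^ (-s - 1) ≤
      (1 / (1 - s) + 2 / (s - 1 / 2)) * ((q' : ℝ) ^ ((1 - s) / 2) / (q : ℝ) ^ (s / 2)) := by
  have h1s : 0 < 1 - s := by linarith
  have hr : 0 < s - 1 / 2 := by linarith
  have hq' : 0 < q' := by omega
  have hq0 : (1 : ℝ) ≤ q := by exact_mod_cast hq
  have hq0' : (q : ℝ) ≤ q' := by exact_mod_cast hqq'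
  set N := Real.sqrt (q * q' : ℝ) with hN
  have hN1 : 1 ≤ N := Real.one_le_sqrt.2 (by nlinarith)
  have hNq' : N ≤ q' := Real.sqrt_le_iff.2 ⟨by linarith, by nlinarith⟩
  set M := ⌊N⌋₊ with hM
  have hM0 : 0 < M := Nat.floor_pos.2 hN1
  have hMN : (M : ℝ) ≤ N := Nat.floor_le (by linarith)
  have hMq' : M ≤ q' := by exact_mod_cast hMN.trans hNq'
  have hNM : N / 2 ≤ M := by
    have h1 := Nat.lt_floor_add_one N
    have h2 : (1 : ℝ) ≤ M := by exact_mod_cast hM0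
    linarith
  set f : ℕ → ℝ := fun n =>
    Real.sqrt (n * min ((n : ℝ) / q) (Real.sqrt (q' / q))) * (n : ℝ) ^ (-s - 1) with hf
  have hf0 : ∀ n, 0 ≤ f n := fun n => by positivity
  have hsub : ∑ n ∈ Finset.Ico q q', f n ≤
      ∑ i ∈ Finset.range M, f (i + 1) + ∑ i ∈ Finset.Ico M q', f (i + 1) := by
    rw [Finset.range_eq_Ico, Finset.sum_Ico_consecutive _ (Nat.zero_le M) hMq',
      Finset.sum_Ico_add' f 0 q' 1]
    refine Finset.sum_le_sum_of_subset_of_nonneg ?_ fun n _ _ => hf0 n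
    exact Finset.Ico_subset_Ico (by omega) (by omega)
  have hlow : ∑ i ∈ Finset.range M, f (i + 1) ≤
      1 / (1 - s) * ((q' : ℝ) ^ ((1 - s) / 2) / (q : ℝ) ^ (s / 2)) := by
    calc ∑ i ∈ Finset.range M, f (i + 1)
        ≤ ∑ i ∈ Finset.range M, (q : ℝ) ^ (-(1 / 2) : ℝ) * ((i + 1 : ℕ) : ℝ) ^ (-s) := by
          refine Finset.sum_le_sum fun i _ => ?_
          have hi : (0 : ℝ) < (i + 1 : ℕ) := by positivity
          calc f (i + 1) ≤ (i + 1 : ℕ) * (q : ℝ) ^ (-(1 / 2) : ℝ) *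
                ((i + 1 : ℕ) : ℝ) ^ (-s - 1) := by
                simp only [hf]
                gcongr
                exact sqrt_mul_min_le_left hq _
            _ = _ := by
                rw [Real.rpow_sub_one hi.ne']
                field_simp
      _ ≤ (q : ℝ) ^ (-(1 / 2) : ℝ) * (N ^ (1 - s) / (1 - s)) := by
          rw [← Finset.mul_sum]
          gcongr
          exact (sum_rpow_neg_le (by linarith) hs2 M).trans (by gcongr)
      _ = _ := by
          rw [← rpow_neg_half_mul_sqrt_rpow hq, ← hN]
          ring
  have hhigh : ∑ i ∈ Finset.Ico M q', f (i + 1) ≤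
      2 / (s - 1 / 2) * ((q' : ℝ) ^ ((1 - s) / 2) / (q : ℝ) ^ (s / 2)) := by
    have hpow : (M : ℝ) ^ (-(s - 1 / 2)) ≤ 2 * N ^ (-(s - 1 / 2)) := by
      calc (M : ℝ) ^ (-(s - 1 / 2)) ≤ (N / 2) ^ (-(s - 1 / 2)) :=
            Real.rpow_le_rpow_of_nonpos (by positivity) hNM (by linarith)
        _ = 2 ^ (s - 1 / 2) * N ^ (-(s - 1 / 2)) := by
            rw [Real.div_rpow (by positivity) (by norm_num),
              Real.rpow_neg (by norm_num : (0 : ℝ) ≤ 2),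
              div_inv_eq_mul, mul_comm]
        _ ≤ 2 ^ (1 : ℝ) * N ^ (-(s - 1 / 2)) := by
            gcongr
            · norm_num
            · linarith
        _ = _ := by rw [Real.rpow_one]
    calc ∑ i ∈ Finset.Ico M q', f (i + 1)
        ≤ ∑ i ∈ Finset.Ico M q', ((q' : ℝ) ^ (1 / 4 : ℝ) * (q : ℝ) ^ (-(1 / 4) : ℝ)) *
            ((i + 1 : ℕ) : ℝ) ^ (-(s - 1 / 2) - 1) := by
          refine Finset.sum_le_sum fun i _ => ?_
          have hi : (0 : ℝ) < (i + 1 : ℕ) := by positivity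
          calc f (i + 1) ≤ ((i + 1 : ℕ) : ℝ) ^ (1 / 2 : ℝ) *
                ((q' : ℝ) ^ (1 / 4 : ℝ) * (q : ℝ) ^ (-(1 / 4) : ℝ)) *
                ((i + 1 : ℕ) : ℝ) ^ (-s - 1) := by
                simp only [hf]
                gcongr
                exact sqrt_mul_min_le_right _
            _ = _ := by
                rw [show -(s - 1 / 2) - 1 = 1 / 2 + (-s - 1) by ring, Real.rpow_add hi]
                ring
      _ ≤ ((q' : ℝ) ^ (1 / 4 : ℝ) * (q : ℝ) ^ (-(1 / 4) : ℝ)) *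
            (2 * N ^ (-(s - 1 / 2)) / (s - 1 / 2)) := by
          rw [← Finset.mul_sum]
          gcongr
          exact (sum_Ico_rpow_le hr hM0 hMq').trans (by gcongr)
      _ = _ := by
          rw [← rpow_quarter_mul_sqrt_rpow hq hq', ← hN]
          ring
  rw [add_mul]
  linarith

end CrossoverBounds

theorem sqrt_mul_one_add_log_le {δ : ℝ} (hδ : 0 < δ) {n : ℕ} (hn : 0 < n) :
    Real.sqrt (n * (1 + Real.log n)) ≤
      Real.sqrt (1 + 1 / (2 * δ)) * (n : ℝ) ^ (1 / 2 + δ) := by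
  have hn0 : (0 : ℝ) < n := by exact_mod_cast hn
  have hn1 : (1 : ℝ) ≤ n := by exact_mod_cast hn
  have h1 : Real.log n ≤ (n : ℝ) ^ (2 * δ) / (2 * δ) := Real.log_le_rpow_div hn0.le (by positivity)
  have h2 : 1 ≤ (n : ℝ) ^ (2 * δ) := Real.one_le_rpow hn1 (by positivity)
  have h3 : (n : ℝ) ^ (1 / 2 + δ) = Real.sqrt (n * (n : ℝ) ^ (2 * δ)) := by
    rw [← Real.rpow_one_add' hn0.le (by positivity), Real.sqrt_eq_rpow, ← Real.rpow_mul hn0.le]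
    ring_nf
  rw [h3, ← Real.sqrt_mul (by positivity)]
  refine Real.sqrt_le_sqrt ?_
  calc n * (1 + Real.log n) ≤ n * ((n : ℝ) ^ (2 * δ) + (n : ℝ) ^ (2 * δ) / (2 * δ)) := by gcongr
    _ = _ := by ring

theorem exists_le_lt_succ_of_tendsto {q : ℕ → ℕ} (hq0 : q 0 = 1) (htop : Tendsto q atTop atTop)
    {n : ℕ} (hn : 0 < n) : ∃ k, q k ≤ n ∧ n < q (k + 1) := by
  classical
  have hex : ∃ k, n < q k := (htop.eventually_gt_atTop n).exists
  have hpos : Nat.find hex ≠ 0 := by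
    intro h
    have := Nat.find_spec hex
    rw [h, hq0] at this
    omega
  obtain ⟨k, hk⟩ := Nat.exists_eq_succ_of_ne_zero hpos
  refine ⟨k, ?_, ?_⟩
  · exact not_lt.1 (Nat.find_min hex (by omega))
  · have := Nat.find_spec hex
    rwa [hk] at this

/-- Summation by parts: a series `∑ a k * b k` converges when the partial sums of `a` are controlled
relative to `b`. -/
theorem exists_tendsto_sum_mul_of_summable {a b : ℕ → ℂ}
    (h0 : Tendsto (fun n => (∑ k ∈ Finset.range n, a k) * b n) atTop (𝓝 0))
    (hs : Summable fun n => (∑ k ∈ Finset.range (n + 1), a k) * (b n - b (n + 1))) :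
    ∃ L, Tendsto (fun n => ∑ k ∈ Finset.range n, a k * b k) atTop (𝓝 L) := by
  have hparts : ∀ n, ∑ k ∈ Finset.range n, a k * b k = (∑ k ∈ Finset.range n, a k) * b n +
      ∑ m ∈ Finset.range n, (∑ k ∈ Finset.range (m + 1), a k) * (b m - b (m + 1)) := by
    intro n
    induction n with
    | zero => simp
    | succ n ih =>
      rw [Finset.sum_range_succ, ih,
        Finset.sum_range_succ (fun m => (∑ k ∈ Finset.range (m + 1), a k) * (b m - b (m + 1))),
        Finset.sum_range_succ a]
      ring
  obtain ⟨L, hL⟩ := hs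
  refine ⟨0 + L, ?_⟩
  simp only [hparts]
  exact h0.add hL.tendsto_sum_nat

section ThetaSeries

variable {s x t : ℝ}

theorem Fpart_eq_sum_range (s : ℝ) (n : ℕ) (x t : ℝ) :
    Fpart s n x t =
      ∑ k ∈ Finset.range n, thetaTerm x t (1 + k) * (((k + 1 : ℕ) : ℝ) ^ (-s) : ℝ) := by
  rw [Fpart]
  induction n with
  | zero => simp
  | succ n ih =>
    rw [Finset.sum_Icc_succ_top (by omega), ih, Finset.sum_range_succ,
      Real.rpow_neg (by positivity),
      Complex.ofReal_inv, Complex.ofReal_cpow (by positivity), div_eq_mul_inv, add_comm 1 n,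
      thetaTerm, Complex.ofReal_natCast]

/-- Pointwise bound for theta sums in terms of consecutive denominators. -/
theorem norm_sum_thetaTerm_succ_le {δ : ℝ} (hδ : 0 < δ) {p : ℤ} {q q' n : ℕ} (hq : 0 < q)
    (hpq : IsCoprime p q) (hup : |q * x - p| ≤ 1 / q')
    (hlow : 1 / (2 * q') ≤ |q * x - p|) (hqn : q ≤ n) (hn : n < q') :
    ‖∑ k ∈ Finset.range n, thetaTerm x t (1 + k)‖ ≤
      8 * Real.sqrt (1 + 1 / (2 * δ)) * (n : ℝ) ^ (1 / 2 + δ) +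
        4 * Real.sqrt (n * min ((n : ℝ) / q) (Real.sqrt (q' / q))) := by
  rw [norm_sum_thetaTerm_shift]
  refine (norm_sum_thetaTerm_le_of_approx hq hpq hup hlow hqn hn _).trans ?_
  have := sqrt_mul_one_add_log_le hδ (by omega : 0 < n)
  linarith

theorem tendsto_norm_sum_thetaTerm_mul_rpow (hs1 : 1 / 2 < s) (hs2 : s < 1)
    (hirr : Irrational x) (t : ℝ)
    (hsum : Summable (fun k : ℕ => Qden x (k + 1) ^ ((1 - s) / 2) / Qden x k ^ (s / 2))) :
    Tendsto (fun n : ℕ => ‖∑ k ∈ Finset.range n, thetaTerm x t (1 + k)‖ * (n : ℝ) ^ (-s))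
      atTop (𝓝 0) := by
  obtain ⟨p, q, hQ, hq0, hmono, htop, hpq, hup, hlow⟩ := hirr.exists_convergents
  simp only [hQ] at hsum
  have hqpos : ∀ k, 0 < q k := fun k => by have := hmono (Nat.zero_le k); omega
  have hex : ∀ n : ℕ, ∃ k, 0 < n → q k ≤ n ∧ n < q (k + 1) := fun n => by
    rcases Nat.eq_zero_or_pos n with h | h
    · exact ⟨0, fun h' => absurd h h'.ne'⟩
    · obtain ⟨k, hk⟩ := exists_le_lt_succ_of_tendsto hq0 htop h
      exact ⟨k, fun _ => hk⟩
  choose κ hκ using hex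
  have hκtop : Tendsto κ atTop atTop := by
    refine tendsto_atTop.2 fun K => ?_
    filter_upwards [eventually_ge_atTop (q K)] with n hn
    by_contra h
    have h1 := (hκ n ((hqpos K).trans_le hn)).2
    have h2 : q (κ n + 1) ≤ q K := hmono (by omega)
    omega
  set δ := (s - 1 / 2) / 2 with hδ_def
  have hδ : 0 < δ := by rw [hδ_def]; linarith
  set C := 8 * Real.sqrt (1 + 1 / (2 * δ)) with hC
  have hlim : Tendsto (fun n : ℕ => C * (n : ℝ) ^ (-δ) +
      4 * ((q (κ n + 1) : ℝ) ^ ((1 - s) / 2) / (q (κ n) : ℝ) ^ (s / 2))) atTop (𝓝 0) := by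
    have h1 := ((tendsto_rpow_neg_atTop hδ).comp tendsto_natCast_atTop_atTop).const_mul C
    have h2 := ((hsum.tendsto_atTop_zero).comp hκtop).const_mul 4
    simpa using h1.add h2
  refine squeeze_zero' (Eventually.of_forall fun n => by positivity) ?_ hlim
  filter_upwards [eventually_gt_atTop 0] with n hn
  have hn0 : (0 : ℝ) < n := by exact_mod_cast hn
  obtain ⟨h1, h2⟩ := hκ n hn
  have h3 := norm_sum_thetaTerm_succ_le (t := t) hδ (hqpos _) (hpq _) (hup _) (hlow _) h1 h2
  have h4 := sqrt_mul_min_mul_rpow_le hs1 hs2 (hqpos (κ n)) (hqpos (κ n + 1)) hn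
  have h5 : (n : ℝ) ^ (1 / 2 + δ) * (n : ℝ) ^ (-s) = (n : ℝ) ^ (-δ) := by
    rw [← Real.rpow_add hn0]
    congr 1
    rw [hδ_def]
    ring
  calc _ ≤ _ := mul_le_mul_of_nonneg_right h3 (by positivity)
    _ = C * ((n : ℝ) ^ (1 / 2 + δ) * (n : ℝ) ^ (-s)) + 4 * (Real.sqrt (n * min ((n : ℝ) / q (κ n))
          (Real.sqrt (q (κ n + 1) / q (κ n)))) * (n : ℝ) ^ (-s)) := by rw [hC]; ring
    _ ≤ _ := by
      rw [h5]
      gcongr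

theorem summable_norm_sum_thetaTerm_mul_rpow (hs1 : 1 / 2 < s) (hs2 : s < 1)
    (hirr : Irrational x) (t : ℝ)
    (hsum : Summable (fun k : ℕ => Qden x (k + 1) ^ ((1 - s) / 2) / Qden x k ^ (s / 2))) :
    Summable fun n : ℕ => ‖∑ k ∈ Finset.range n, thetaTerm x t (1 + k)‖ * (n : ℝ) ^ (-s - 1) := by
  obtain ⟨p, q, hQ, hq0, hmono, htop, hpq, hup, hlow⟩ := hirr.exists_convergents
  simp only [hQ] at hsum
  have hqpos : ∀ k, 0 < q k := fun k => by have := hmono (Nat.zero_le k); omega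
  set δ := (s - 1 / 2) / 2 with hδ_def
  have hδ : 0 < δ := by rw [hδ_def]; linarith
  set C := 8 * Real.sqrt (1 + 1 / (2 * δ)) with hC
  set D := 4 * (1 / (1 - s) + 2 / (s - 1 / 2)) with hD
  have hD0 : 0 ≤ D := by
    have h1 : 0 < 1 - s := by linarith
    have h2 : 0 < s - 1 / 2 := by linarith
    positivity
  set g : ℕ → ℝ := fun n =>
    ‖∑ k ∈ Finset.range n, thetaTerm x t (1 + k)‖ * (n : ℝ) ^ (-s - 1) with hg
  have hg0 : ∀ n, 0 ≤ g n := fun n => by positivity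
  set T : ℕ → ℝ := fun k => (q (k + 1) : ℝ) ^ ((1 - s) / 2) / (q k : ℝ) ^ (s / 2) with hT
  have hT0 : ∀ k, 0 ≤ T k := fun k => by positivity
  have hZ : Summable fun n : ℕ => (n : ℝ) ^ (-δ - 1) :=
    Real.summable_nat_rpow.2 (by linarith)
  have hblock : ∀ k, ∑ n ∈ Finset.Ico (q k) (q (k + 1)), g n ≤
      ∑ n ∈ Finset.Ico (q k) (q (k + 1)), C * (n : ℝ) ^ (-δ - 1) + D * T k := by
    intro k
    have h1 := sum_Ico_sqrt_mul_min_mul_rpow_le hs1 hs2 (hqpos k) (hmono (Nat.le_add_right k 1))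
    have h2 : ∑ n ∈ Finset.Ico (q k) (q (k + 1)), g n ≤
        ∑ n ∈ Finset.Ico (q k) (q (k + 1)), (C * (n : ℝ) ^ (-δ - 1) +
          4 * (Real.sqrt (n * min ((n : ℝ) / q k) (Real.sqrt (q (k + 1) / q k))) *
            (n : ℝ) ^ (-s - 1))) := by
      refine Finset.sum_le_sum fun n hn => ?_
      rw [Finset.mem_Ico] at hn
      have hn0 : (0 : ℝ) < n := by exact_mod_cast (hqpos k).trans_le hn.1
      have h3 := norm_sum_thetaTerm_succ_le (t := t) hδ (hqpos k) (hpq k) (hup k) (hlow k) hn.1 hn.2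
      have h5 : (n : ℝ) ^ (1 / 2 + δ) * (n : ℝ) ^ (-s - 1) = (n : ℝ) ^ (-δ - 1) := by
        rw [← Real.rpow_add hn0]
        congr 1
        rw [hδ_def]
        ring
      rw [← h5]
      refine (mul_le_mul_of_nonneg_right h3 (by positivity)).trans_eq ?_
      rw [hC]
      ring
    have h7 : ∑ n ∈ Finset.Ico (q k) (q (k + 1)), 4 * (Real.sqrt (n * min ((n : ℝ) / q k)
        (Real.sqrt (q (k + 1) / q k))) * (n : ℝ) ^ (-s - 1)) =
      4 * ∑ n ∈ Finset.Ico (q k) (q (k + 1)), Real.sqrt (n * min ((n : ℝ) / q k)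
        (Real.sqrt (q (k + 1) / q k))) * (n : ℝ) ^ (-s - 1) := (Finset.mul_sum _ _ _).symm
    rw [Finset.sum_add_distrib, h7] at h2
    have h6 : D * T k = 4 * ((1 / (1 - s) + 2 / (s - 1 / 2)) *
      ((q (k + 1) : ℝ) ^ ((1 - s) / 2) / (q k : ℝ) ^ (s / 2))) := by rw [hD, mul_assoc]
    linarith
  have hpartial : ∀ K, ∑ n ∈ Finset.range (q K), g n ≤
      ∑ n ∈ Finset.range (q K), C * (n : ℝ) ^ (-δ - 1) + D * ∑ k ∈ Finset.range K, T k := by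
    intro K
    induction K with
    | zero =>
      rw [hq0]
      simp [hg, Real.zero_rpow (by linarith : -δ - 1 ≠ 0)]
    | succ K ih =>
      have hle : q K ≤ q (K + 1) := hmono K.le_succ
      rw [← Finset.sum_range_add_sum_Ico g hle,
        ← Finset.sum_range_add_sum_Ico (fun n : ℕ => C * (n : ℝ) ^ (-δ - 1)) hle,
        Finset.sum_range_succ, mul_add]
      linarith [hblock K]
  refine summable_of_sum_range_le (c := C * ∑' n : ℕ, (n : ℝ) ^ (-δ - 1) + D * ∑' k, T k) hg0
    fun n => ?_
  obtain ⟨K, hK⟩ := (htop.eventually_ge_atTop n).exists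
  calc ∑ i ∈ Finset.range n, g i ≤ ∑ i ∈ Finset.range (q K), g i :=
        Finset.sum_le_sum_of_subset_of_nonneg (Finset.range_mono hK) fun i _ _ => hg0 i
    _ ≤ C * ∑ n ∈ Finset.range (q K), (n : ℝ) ^ (-δ - 1) + D * ∑ k ∈ Finset.range K, T k := by
        rw [Finset.mul_sum]
        exact hpartial K
    _ ≤ _ := by
        gcongr
        · exact hZ.sum_le_tsum _ fun n _ => by positivity
        · exact hsum.sum_le_tsum _ fun k _ => hT0 k

end ThetaSeries

/-- convergence of `F_s(x,t)` for `s ∈ (1/2,1)` under the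
condition `Σ Q_{k+1}^{(1-s)/2}/Q_k^{s/2} < ∞`. -/
theorem stmt0 (s : ℝ) (hs1 : 1 / 2 < s) (hs2 : s < 1)
    (x : ℝ) (hx : x ∈ Set.Ioo (0 : ℝ) 1) (hirr : Irrational x) (t : ℝ)
    (hsum : Summable (fun k : ℕ => Qden x (k + 1) ^ ((1 - s) / 2) / Qden x k ^ (s / 2))) :
    ∃ L : ℂ, Tendsto (fun n : ℕ => Fpart s n x t) atTop (𝓝 L) := by
  have hlim := tendsto_norm_sum_thetaTerm_mul_rpow hs1 hs2 hirr t hsum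
  have hsummable := summable_norm_sum_thetaTerm_mul_rpow hs1 hs2 hirr t hsum
  simp only [Fpart_eq_sum_range]
  refine exists_tendsto_sum_mul_of_summable
    (b := fun k => (((((k + 1 : ℕ) : ℝ) ^ (-s) : ℝ)) : ℂ)) ?_ ?_
  · refine squeeze_zero_norm' ?_ hlim
    filter_upwards [eventually_gt_atTop 0] with n hn
    have hn0 : (0 : ℝ) < n := by exact_mod_cast hn
    rw [norm_mul, Complex.norm_real, Real.norm_of_nonneg (by positivity)]
    gcongr ?_ * ?_
    exact Real.rpow_le_rpow_of_nonpos hn0 (by push_cast; linarith) (by linarith)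
  · refine Summable.of_norm_bounded ((summable_nat_add_iff 1).2 hsummable) fun n => ?_
    rw [norm_mul, ← Complex.ofReal_sub, Complex.norm_real, Real.norm_of_nonneg]
    · gcongr
      exact rpow_neg_sub_rpow_neg_succ_le (by linarith) hs2.le (n + 1) n.succ_pos
    · rw [sub_nonneg]
      exact Real.rpow_le_rpow_of_nonpos (by positivity) (by push_cast; linarith) (by linarith)
end

section
/- There exists an absolute constant C > 0 such that for every irrational x ∈ (0,1) with regular continued fraction convergent denominators (Q_k)_{k≥0}, every t ∈ ℝ, and all integers N ≥ 1 and r ≥ 0, one has |Σ_{k=1}^{N} e^{iπk²x + 2πikt}| ≤ C (N/√(Q_r) + √(Q_r)). -/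
open Complex Filter Finset

open scoped Real
open MeasureTheory Topology

/-- Two horizontal line integrals of a function holomorphic in the strip between the lines agree,
provided that the function decays at both ends of the strip. -/
theorem integral_line_eq_of_differentiableOn_strip {f : ℂ → ℂ} {d : ℝ} (hd : 0 ≤ d)
    (hf : DifferentiableOn ℂ f {w | |w.im| ≤ d}) {φ : ℝ → ℝ} (hφ : Tendsto φ atTop (𝓝 0)) {R₀ : ℝ}
    (hb : ∀ u v : ℝ, R₀ ≤ |u| → |v| ≤ d → ‖f (u + v * I)‖ ≤ φ |u|)
    (h₁ : Integrable fun u : ℝ => f (u + ((-d : ℝ) : ℂ) * I))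
    (h₂ : Integrable fun u : ℝ => f (u + (d : ℂ) * I)) :
    ∫ u : ℝ, f (u + ((-d : ℝ) : ℂ) * I) = ∫ u : ℝ, f (u + (d : ℂ) * I) := by
  have t₁ := intervalIntegral_tendsto_integral h₁ tendsto_neg_atTop_atBot tendsto_id
  have t₂ := intervalIntegral_tendsto_integral h₂ tendsto_neg_atTop_atBot tendsto_id
  have t₃ := t₁.sub t₂
  have t₄ : Tendsto (fun R : ℝ => (∫ u : ℝ in -R..id R, f (u + ((-d : ℝ) : ℂ) * I)) -
      ∫ u : ℝ in -R..id R, f (u + (d : ℂ) * I)) atTop (𝓝 0) := by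
    refine squeeze_zero_norm' (a := fun R => φ R * |d - -d| + φ R * |d - -d|) ?_ ?_
    · filter_upwards [eventually_ge_atTop R₀, eventually_ge_atTop 0] with R hR hR0
      have key := integral_boundary_rect_eq_zero_of_differentiableOn f
        ((-R : ℝ) + ((-d : ℝ) : ℂ) * I) ((R : ℝ) + (d : ℂ) * I) (by
          refine hf.mono fun w hw => ?_
          have := hw.2
          simp only [add_im, ofReal_im, mul_im, ofReal_re, I_im, I_re, mul_one, mul_zero,
            add_zero, zero_add, Set.mem_preimage] at this
          rw [Set.uIcc_of_le (by linarith)] at this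
          exact abs_le.2 this)
      simp only [add_re, add_im, ofReal_im, mul_im, mul_re, ofReal_re, I_im, I_re, mul_one,
        mul_zero, add_zero, zero_add, sub_self] at key
      have b : ∀ S : ℝ, |S| = R →
          ‖∫ y : ℝ in (-d)..d, f (S + y * I)‖ ≤ φ R * |d - -d| := by
        intro S hS
        refine intervalIntegral.norm_integral_le_of_norm_le_const fun y hy => ?_
        rw [Set.uIoc_of_le (by linarith)] at hy
        have := hb S y (by rw [hS]; exact hR) (abs_le.2 ⟨hy.1.le, hy.2⟩)
        rwa [hS] at this
      have e : (∫ u : ℝ in -R..id R, f (u + ((-d : ℝ) : ℂ) * I)) -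
          ∫ u : ℝ in -R..id R, f (u + (d : ℂ) * I) =
          I • (∫ y : ℝ in (-d)..d, f ((-R : ℝ) + y * I)) -
            I • (∫ y : ℝ in (-d)..d, f (R + y * I)) := by
        simp only [id]
        linear_combination key
      rw [e]
      refine (norm_sub_le _ _).trans ?_
      rw [norm_smul, norm_smul, norm_I, one_mul, one_mul]
      exact add_le_add (b (-R) (by rw [abs_neg, abs_of_nonneg hR0])) (b R (abs_of_nonneg hR0))
    · simpa using (hφ.mul_const |d - -d|).add (hφ.mul_const |d - -d|)
  exact sub_eq_zero.1 (tendsto_nhds_unique t₃ t₄)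

theorem rho_eq : ρ = (√2 / 2 : ℝ) * (1 + I) := by
  rw [ρ, show (π : ℂ) * I / 4 = ((π / 4 : ℝ) : ℂ) * I by push_cast; ring, exp_mul_I,
    ← ofReal_cos, ← ofReal_sin, Real.cos_pi_div_four, Real.sin_pi_div_four]
  ring

theorem rho_sq : ρ ^ 2 = I := by
  rw [ρ, ← Complex.exp_nat_mul, show ((2 : ℕ) : ℂ) * (π * I / 4) = π / 2 * I by push_cast; ring,
    exp_pi_div_two_mul_I]

theorem rho_re : ρ.re = √2 / 2 := by rw [rho_eq, re_ofReal_mul]; simp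

theorem rho_im : ρ.im = √2 / 2 := by rw [rho_eq, im_ofReal_mul]; simp

theorem norm_rho : ‖ρ‖ = 1 := by
  have h : ‖ρ‖ ^ 2 = 1 := by rw [← norm_pow, rho_sq, norm_I]
  exact (pow_eq_one_iff_of_nonneg (norm_nonneg _) two_ne_zero).1 h

/-- The Mordell integral along the steepest-descent direction `ρ`. -/
noncomputable def mordell (x β : ℝ) : ℂ :=
  ∫ u : ℝ, Complex.exp (-(π * x) * u ^ 2 + 2 * π * I * ρ * β * u) / (1 + Complex.exp (2 * π * I * ρ * u))

theorem norm_cexp_rho (β u : ℝ) :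
    ‖Complex.exp (2 * π * I * ρ * β * u)‖ = Real.exp (-(β * (√2 * π * u))) := by
  rw [Complex.norm_exp]
  congr 1
  rw [show 2 * π * I * ρ * β * u = ((2 * π * β * u : ℝ) : ℂ) * (I * ρ) by push_cast; ring,
    re_ofReal_mul, I_mul_re, rho_im]
  ring

theorem one_add_exp_le (s : ℝ) {z : ℂ} (hz : z = Complex.exp (s * (-1 + I))) :
    1 + Real.exp (-s) ≤ 4 * ‖1 + z‖ := by
  have hn : ‖z‖ = Real.exp (-s) := by
    rw [hz, Complex.norm_exp, re_ofReal_mul]; simp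
  have hre : z.re = Real.exp (-s) * Real.cos s := by
    rw [hz, Complex.exp_re, re_ofReal_mul, im_ofReal_mul]; simp
  have he1 := Real.add_one_le_exp (1 : ℝ)
  have he2 := Real.exp_one_lt_d9
  rcases le_or_gt 1 s with h | h
  · have : Real.exp (-s) ≤ 1 / 2 := by
      rw [Real.exp_neg, inv_le_comm₀ (Real.exp_pos _) (by norm_num)]
      have := Real.exp_le_exp.2 h
      norm_num; linarith
    have := norm_sub_le (1 + z) z
    rw [add_sub_cancel_right, norm_one, hn] at this
    linarith
  rcases le_or_gt s (-1) with h' | h'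
  · have : 2 ≤ Real.exp (-s) := by
      have := Real.exp_le_exp.2 (show (1 : ℝ) ≤ -s by linarith)
      linarith
    have := norm_sub_le (1 + z) 1
    rw [add_sub_cancel_left, norm_one, hn] at this
    linarith
  · have hc : 0 ≤ Real.cos s := Real.cos_nonneg_of_mem_Icc
      ⟨by linarith [Real.pi_gt_three], by linarith [Real.pi_gt_three]⟩
    have h1 : 1 ≤ ‖1 + z‖ := by
      refine le_trans ?_ (re_le_norm _)
      rw [add_re, one_re, hre]
      have := mul_nonneg (Real.exp_pos (-s)).le hc
      linarith
    have := Real.exp_le_exp.2 (show -s ≤ (1 : ℝ) by linarith)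
    linarith

theorem one_add_exp_le_norm (u : ℝ) :
    1 + Real.exp (-(√2 * π * u)) ≤ 4 * ‖1 + Complex.exp (2 * π * I * ρ * u)‖ := by
  refine one_add_exp_le _ ?_
  rw [rho_eq]
  push_cast
  congr 1
  linear_combination (√2 * π * u) * I_sq

theorem integrable_cexp_gaussian {x : ℝ} (hx : 0 < x) (c : ℂ) :
    Integrable fun u : ℝ => Complex.exp (-(π * x) * u ^ 2 + c * u) := by
  have := integrable_cexp_quadratic (b := (π * x : ℝ)) (by simpa using by positivity) c 0
  simpa using this

theorem one_add_cexp_ne_zero (u : ℝ) : 1 + Complex.exp (2 * π * I * ρ * u) ≠ 0 := by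
  intro h
  have := one_add_exp_le_norm u
  rw [h, norm_zero] at this
  linarith [Real.exp_pos (-(√2 * π * u))]

theorem integrable_mordell {x : ℝ} (hx : 0 < x) (β : ℝ) : Integrable fun u : ℝ =>
    Complex.exp (-(π * x) * u ^ 2 + 2 * π * I * ρ * β * u) / (1 + Complex.exp (2 * π * I * ρ * u)) := by
  simp_rw [div_eq_mul_inv]
  refine (integrable_cexp_gaussian hx _).mul_bdd (c := 4) ?_ (ae_of_all _ fun u => ?_)
  · refine Continuous.aestronglyMeasurable (Continuous.inv₀ (by fun_prop) one_add_cexp_ne_zero)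
  · rw [norm_inv, inv_le_comm₀ (norm_pos_iff.2 (one_add_cexp_ne_zero u)) (by norm_num)]
    linarith [one_add_exp_le_norm u, Real.exp_pos (-(√2 * π * u))]

theorem norm_mordell_le {x β : ℝ} (hx : 0 < x) (h0 : 0 ≤ β) (h1 : β ≤ 1) :
    ‖mordell x β‖ ≤ 4 / √x := by
  have hg : ∫ u : ℝ, 4 * Real.exp (-(π * x) * u ^ 2) = 4 / √x := by
    rw [integral_const_mul, integral_gaussian, div_mul_cancel_left₀ Real.pi_ne_zero, Real.sqrt_inv,
      div_eq_mul_inv]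
  rw [← hg]
  refine norm_integral_le_of_norm_le
    ((integrable_exp_neg_mul_sq (by positivity)).const_mul _) (ae_of_all _ fun u => ?_)
  rw [Complex.exp_add, norm_div, norm_mul, norm_cexp_rho,
    div_le_iff₀ (norm_pos_iff.2 (one_add_cexp_ne_zero u)), Complex.norm_exp]
  have e : (-(π * x : ℂ) * (u : ℂ) ^ 2).re = -(π * x) * u ^ 2 := by
    rw [← ofReal_re (-(π * x) * u ^ 2)]; push_cast; rfl
  rw [e]
  have hs : Real.exp (-(β * (√2 * π * u))) ≤ 1 + Real.exp (-(√2 * π * u)) := by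
    rcases le_total 0 (√2 * π * u) with h | h
    · have : Real.exp (-(β * (√2 * π * u))) ≤ 1 := Real.exp_le_one_iff.2 (by nlinarith)
      linarith [Real.exp_pos (-(√2 * π * u))]
    · have : Real.exp (-(β * (√2 * π * u))) ≤ Real.exp (-(√2 * π * u)) :=
        Real.exp_le_exp.2 (by nlinarith)
      linarith
  calc _ ≤ Real.exp (-(π * x) * u ^ 2) * (4 * ‖1 + Complex.exp (2 * π * I * ρ * u)‖) := by
        gcongr
        exact hs.trans (one_add_exp_le_norm u)
    _ = _ := by ring

theorem mordell_add_mordell_add_one {x : ℝ} (hx : 0 < x) (β : ℝ) :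
    mordell x β + mordell x (β + 1) = (1 / √x : ℝ) * Complex.exp (-(π * I * β ^ 2 / x)) := by
  have hx' : (x : ℂ) ≠ 0 := ofReal_ne_zero.2 hx.ne'
  have hπ : (π : ℂ) ≠ 0 := ofReal_ne_zero.2 Real.pi_ne_zero
  rw [mordell, mordell, ← integral_add (integrable_mordell hx _) (integrable_mordell hx _)]
  have h : ∀ u : ℝ, Complex.exp (-(π * x) * u ^ 2 + 2 * π * I * ρ * β * u) / (1 + Complex.exp (2 * π * I * ρ * u))
      + Complex.exp (-(π * x) * u ^ 2 + 2 * π * I * ρ * (β + 1 : ℝ) * u) / (1 + Complex.exp (2 * π * I * ρ * u)) =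
      Complex.exp (-(π * x : ℝ) * u ^ 2 + 2 * π * I * ρ * β * u + 0) := by
    intro u
    rw [← add_div, div_eq_iff (one_add_cexp_ne_zero u), mul_add, mul_one, ← Complex.exp_add]
    push_cast
    congr 2 <;> ring
  simp_rw [h]
  rw [integral_cexp_quadratic (by simpa using by positivity), neg_neg]
  congr 1
  · rw [show (π : ℂ) / (π * x : ℝ) = ((1 / x : ℝ) : ℂ) by push_cast; field_simp,
      show (1 / 2 : ℂ) = ((1 / 2 : ℝ) : ℂ) by push_cast; rfl, ← ofReal_cpow (by positivity),
      ← Real.sqrt_eq_rpow, Real.sqrt_div zero_le_one, Real.sqrt_one]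
  · congr 1
    push_cast
    field_simp
    linear_combination (4 * π * β ^ 2 * I ^ 2) * rho_sq + 4 * π * β ^ 2 * I * I_sq

theorem norm_gaussian_div_le {x : ℝ} (hx : 0 < x) (c : ℂ) {u v : ℝ} (hu : 1 ≤ |u|)
    (hv : |v| ≤ √2 / 4) :
    ‖Complex.exp (-(π * x) * (u + v * I) ^ 2 + c * (u + v * I)) /
      (1 - Complex.exp (2 * π * I * ρ * (u + v * I)))‖ ≤
      2 * Real.exp (-(π * x) * |u| ^ 2 + π * x + ‖c‖ * (|u| + 1)) := by
  have h2 : (√2) ^ 2 = 2 := Real.sq_sqrt zero_le_two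
  have h2' : 1 ≤ √2 := Real.one_le_sqrt.2 one_le_two
  have hv1 : |v| ≤ 1 / 2 := hv.trans (by nlinarith)
  have hvv := abs_le.1 hv1
  have hden : 1 / 2 ≤ ‖1 - Complex.exp (2 * π * I * ρ * (u + v * I))‖ := by
    have hn : ‖Complex.exp (2 * π * I * ρ * (u + v * I))‖ = Real.exp (-(√2 * π * (u + v))) := by
      rw [Complex.norm_exp]
      congr 1
      rw [show 2 * π * I * ρ * (u + v * I) = ((2 * π : ℝ) : ℂ) * (I * (ρ * (u + v * I))) by
        push_cast; ring, re_ofReal_mul, I_mul_re, mul_im, rho_re, rho_im]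
      simp
      ring
    have he1 := Real.add_one_le_exp (1 : ℝ)
    have hs : 1 ≤ √2 * π * (1 / 2) := by nlinarith [Real.pi_gt_three]
    rcases le_abs'.1 hu with h | h
    · have : 2 ≤ Real.exp (-(√2 * π * (u + v))) := by
        have := Real.exp_le_exp.2 (show (1 : ℝ) ≤ -(√2 * π * (u + v)) by
          nlinarith [mul_pos (show 0 < √2 by linarith) Real.pi_pos])
        linarith
      have := norm_sub_norm_le (Complex.exp (2 * π * I * ρ * (u + v * I))) 1
      rw [norm_one, hn, norm_sub_rev] at this
      linarith
    · have : Real.exp (-(√2 * π * (u + v))) ≤ 1 / 2 := by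
        rw [Real.exp_neg, inv_le_comm₀ (Real.exp_pos _) (by norm_num)]
        have := Real.exp_le_exp.2 (show (1 : ℝ) ≤ √2 * π * (u + v) by
          nlinarith [mul_pos (show 0 < √2 by linarith) Real.pi_pos])
        norm_num; linarith
      have := norm_sub_norm_le 1 (Complex.exp (2 * π * I * ρ * (u + v * I)))
      rw [norm_one, hn] at this
      linarith
  have hnum : ‖Complex.exp (-(π * x) * (u + v * I) ^ 2 + c * (u + v * I))‖ ≤
      Real.exp (-(π * x) * |u| ^ 2 + π * x + ‖c‖ * (|u| + 1)) := by
    rw [Complex.norm_exp, Real.exp_le_exp, add_re]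
    have e : (-(π * x : ℂ) * (u + v * I) ^ 2).re = -(π * x) * |u| ^ 2 + π * x * |v| ^ 2 := by
      rw [show -(π * x : ℂ) * (u + v * I) ^ 2 = ((-(π * x) : ℝ) : ℂ) * (u + v * I) ^ 2 by
        push_cast; rfl, re_ofReal_mul, sq_abs, sq_abs]
      simp [pow_two]
      ring
    have hπx : 0 < π * x := by positivity
    have e2 : π * x * |v| ^ 2 ≤ π * x :=
      mul_le_of_le_one_right hπx.le (by nlinarith [abs_nonneg v])
    have e3 : (c * (u + v * I)).re ≤ ‖c‖ * (|u| + 1) := by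
      refine (re_le_norm _).trans ?_
      rw [norm_mul]
      gcongr
      refine (norm_add_le _ _).trans ?_
      rw [norm_mul, norm_I, mul_one, norm_real, norm_real, Real.norm_eq_abs, Real.norm_eq_abs]
      linarith
    linarith
  rw [norm_div, div_le_iff₀ (by linarith)]
  nlinarith [Real.exp_pos (-(π * x) * |u| ^ 2 + π * x + ‖c‖ * (|u| + 1))]

theorem tendsto_exp_neg_sq_add {a : ℝ} (ha : 0 < a) (b c : ℝ) :
    Tendsto (fun u : ℝ => 2 * Real.exp (-a * u ^ 2 + c + b * (u + 1))) atTop (𝓝 0) := by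
  rw [← mul_zero (2 : ℝ)]
  refine (Real.tendsto_exp_atBot.comp ?_).const_mul 2
  have h1 : Tendsto (fun u : ℝ => u * (b + -a * u)) atTop atBot :=
    tendsto_id.atTop_mul_atBot₀
      (tendsto_atBot_add_const_left _ b (tendsto_id.const_mul_atTop_of_neg (neg_lt_zero.2 ha)))
  refine (tendsto_atBot_add_const_right _ (c + b) h1).congr fun u => ?_
  ring

theorem one_sub_cexp_rho_ne_zero {w : ℂ} (hw : |w.im| ≤ √2 / 4) (h0 : w ≠ 0) :
    1 - Complex.exp (2 * π * I * ρ * w) ≠ 0 := by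
  intro h
  obtain ⟨n, hn⟩ := Complex.exp_eq_one_iff.1 (sub_eq_zero.1 h).symm
  have h3 : ρ * w = n := by
    apply mul_left_cancel₀ two_pi_I_ne_zero
    linear_combination hn
  have h4 : w = -I * ρ * n := by
    rw [← h3]
    linear_combination (I * w) * rho_sq + w * I_sq
  have h5 : w.im = -(√2 / 2 * n) := by
    rw [h4, show -I * ρ * n = ((n : ℝ) : ℂ) * -(I * ρ) by push_cast; ring, im_ofReal_mul, neg_im,
      I_mul_im, rho_re]
    ring
  have h2' : 0 < √2 := by positivity
  rw [h5, abs_neg, abs_mul, abs_of_pos (by positivity)] at hw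
  have h6 : |(n : ℝ)| < 1 := by nlinarith
  have h7 : n = 0 := by
    rw [← Int.cast_abs] at h6
    exact Int.abs_lt_one_iff.1 (by exact_mod_cast h6)
  apply h0
  rw [h4, h7]
  simp

theorem integrand_on_line (x t σ u : ℝ) (hσ : σ ^ 2 = 1) :
    Complex.exp (-(π * x) * (u + σ * (√2 / 4 * (1 - I))) ^ 2 +
        2 * π * I * t * ρ * (u + σ * (√2 / 4 * (1 - I)))) /
      (1 - Complex.exp (2 * π * I * ρ * (u + σ * (√2 / 4 * (1 - I))))) =
    Complex.exp (π * I * x / 4 + σ * (π * I * t)) *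
      (Complex.exp (-(π * x) * u ^ 2 + 2 * π * I * ρ * (t + σ * (x / 2) : ℝ) * u) /
        (1 + Complex.exp (2 * π * I * ρ * u))) := by
  have h2 : ((√2 : ℝ) : ℂ) ^ 2 = 2 := by exact_mod_cast Real.sq_sqrt zero_le_two
  have hκ : (√2 / 4 * (1 - I) : ℂ) = -I * ρ / 2 := by
    rw [rho_eq]; push_cast
    linear_combination (√2 / 4 : ℂ) * I_sq
  have hσ' : (σ : ℂ) ^ 2 = 1 := by exact_mod_cast hσ
  have hs : Complex.exp (2 * π * I * ρ * (u + σ * (√2 / 4 * (1 - I)))) =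
      -Complex.exp (2 * π * I * ρ * u) := by
    have : Complex.exp (σ * (π * I)) = -1 := by
      rcases mul_self_eq_one_iff.1 (by rw [← sq, hσ] : σ * σ = 1) with h | h <;> simp [h, Complex.exp_neg]
    rw [← mul_neg_one, ← this, ← Complex.exp_add, hκ]
    congr 1
    linear_combination (-π * σ * I ^ 2) * rho_sq - (π * σ * I) * I_sq
  rw [hs, sub_neg_eq_add, ← mul_div_assoc, ← Complex.exp_add, hκ]
  congr 2
  push_cast
  linear_combination (-π * x / 4 : ℂ) * (I ^ 2 * ρ ^ 2 * hσ' + I ^ 2 * rho_sq + I * I_sq) -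
    (π * t * σ : ℂ) * (I ^ 2 * rho_sq + I * I_sq)

theorem integral_gaussian_div_line {x t σ : ℝ} (hσ : σ ^ 2 = 1) :
    ∫ u : ℝ, Complex.exp (-(π * x) * (u + σ * (√2 / 4 * (1 - I))) ^ 2 +
        2 * π * I * t * ρ * (u + σ * (√2 / 4 * (1 - I)))) /
      (1 - Complex.exp (2 * π * I * ρ * (u + σ * (√2 / 4 * (1 - I))))) =
    Complex.exp (π * I * x / 4 + σ * (π * I * t)) * mordell x (t + σ * (x / 2)) := by
  simp_rw [integrand_on_line x t σ _ hσ]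
  rw [integral_const_mul, mordell]

theorem integrable_gaussian_div_line {x : ℝ} (hx : 0 < x) (t : ℝ) {σ : ℝ} (hσ : σ ^ 2 = 1) :
    Integrable fun u : ℝ => Complex.exp (-(π * x) * (u + σ * (√2 / 4 * (1 - I))) ^ 2 +
        2 * π * I * t * ρ * (u + σ * (√2 / 4 * (1 - I)))) /
      (1 - Complex.exp (2 * π * I * ρ * (u + σ * (√2 / 4 * (1 - I))))) := by
  simp_rw [integrand_on_line x t σ _ hσ]
  exact (integrable_mordell hx _).const_mul _

/-- The difference of the values of the Mordell integral on the two sides of a pole, up to the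
factor `exp (π i x / 4)`. -/
noncomputable def mordellJump (x t : ℝ) : ℂ :=
  Complex.exp (π * I * x / 4 + (-1 : ℝ) * (π * I * t)) * mordell x (t + (-1 : ℝ) * (x / 2)) -
    Complex.exp (π * I * x / 4 + (1 : ℝ) * (π * I * t)) * mordell x (t + (1 : ℝ) * (x / 2))

theorem mordellJump_congr {x y : ℝ} (hx : 0 < x) (hy : 0 < y) (t s : ℝ) :
    mordellJump x t = mordellJump y s := by
  set F : ℝ → ℝ → ℂ → ℂ := fun x t w => Complex.exp (-(π * x) * w ^ 2 + 2 * π * I * t * ρ * w)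
    with hF
  set E : ℂ → ℂ := fun w => 1 - Complex.exp (2 * π * I * ρ * w) with hE
  set D : ℂ → ℂ := fun w => F x t w - F y s w with hD
  set Φ : ℂ → ℂ := fun w => dslope D 0 w / dslope E 0 w with hΦ
  have hDd : Differentiable ℂ D := by simp only [hD, hF]; fun_prop
  have hEd : Differentiable ℂ E := by simp only [hE]; fun_prop
  have hD0 : D 0 = 0 := by simp [hD, hF]
  have hE0 : E 0 = 0 := by simp [hE]
  have hΦ_of_ne : ∀ w, w ≠ 0 → Φ w = F x t w / E w - F y s w / E w := by
    intro w hw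
    simp only [hΦ]
    rw [dslope_of_ne _ hw, dslope_of_ne _ hw, slope_def_field, slope_def_field, hD0, hE0,
      sub_zero, sub_zero, sub_zero, div_div_div_cancel_right₀ hw, ← sub_div]
  have hdE : ∀ w : ℂ, |w.im| ≤ √2 / 4 → dslope E 0 w ≠ 0 := by
    intro w hw
    rcases eq_or_ne w 0 with rfl | h0
    · have h1 : HasDerivAt E (-(2 * π * I * ρ)) 0 := by
        have h := (((hasDerivAt_id (0 : ℂ)).const_mul (2 * π * I * ρ)).cexp).const_sub 1
        simpa using h
      rw [dslope_same, h1.deriv, neg_ne_zero]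
      refine mul_ne_zero two_pi_I_ne_zero (norm_ne_zero_iff.1 ?_)
      rw [norm_rho]
      exact one_ne_zero
    · rw [dslope_of_ne _ h0, slope_def_field, hE0, sub_zero, sub_zero]
      exact div_ne_zero (one_sub_cexp_rho_ne_zero hw h0) h0
  have hΦd : DifferentiableOn ℂ Φ {w | |w.im| ≤ √2 / 4} := by
    have h1 : DifferentiableOn ℂ (dslope D 0) Set.univ :=
      (differentiableOn_dslope univ_mem).2 hDd.differentiableOn
    have h2 : DifferentiableOn ℂ (dslope E 0) Set.univ :=
      (differentiableOn_dslope univ_mem).2 hEd.differentiableOn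
    exact (h1.mono (Set.subset_univ _)).div (h2.mono (Set.subset_univ _)) hdE
  have hline : ∀ σ : ℝ, σ ^ 2 = 1 → ∀ u : ℝ,
      Φ ((u + σ * (√2 / 4) : ℝ) + (-(σ * (√2 / 4)) : ℝ) * I) =
      F x t (u + σ * (√2 / 4 * (1 - I))) / E (u + σ * (√2 / 4 * (1 - I))) -
      F y s (u + σ * (√2 / 4 * (1 - I))) / E (u + σ * (√2 / 4 * (1 - I))) := by
    intro σ hσ u
    rw [hΦ_of_ne]
    · have : ((u + σ * (√2 / 4) : ℝ) : ℂ) + (-(σ * (√2 / 4)) : ℝ) * I =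
        u + σ * (√2 / 4 * (1 - I)) := by push_cast; ring
      rw [this]
    · intro h
      have := congrArg Complex.im h
      simp at this
      rw [this] at hσ
      norm_num at hσ
  have hint : ∀ σ : ℝ, σ ^ 2 = 1 → Integrable fun u : ℝ => Φ (u + (-(σ * (√2 / 4)) : ℝ) * I) := by
    intro σ hσ
    have h := ((integrable_gaussian_div_line hx t hσ).sub
      (integrable_gaussian_div_line hy s hσ)).congr (ae_of_all _ fun u => (hline σ hσ u).symm)
    simpa only [sub_add_cancel] using h.comp_sub_right (σ * (√2 / 4))
  have hval : ∀ σ : ℝ, σ ^ 2 = 1 → ∫ u : ℝ, Φ (u + (-(σ * (√2 / 4)) : ℝ) * I) =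
      Complex.exp (π * I * x / 4 + σ * (π * I * t)) * mordell x (t + σ * (x / 2)) -
      Complex.exp (π * I * y / 4 + σ * (π * I * s)) * mordell y (s + σ * (y / 2)) := by
    intro σ hσ
    rw [← integral_add_right_eq_self _ (σ * (√2 / 4))]
    simp_rw [hline σ hσ]
    rw [integral_sub (integrable_gaussian_div_line hx t hσ) (integrable_gaussian_div_line hy s hσ),
      ← integral_gaussian_div_line hσ, ← integral_gaussian_div_line hσ]
  have key := integral_line_eq_of_differentiableOn_strip (f := Φ) (d := √2 / 4) (by positivity) hΦd
    (φ := fun u => 2 * Real.exp (-(π * x) * u ^ 2 + π * x + ‖2 * π * I * t * ρ‖ * (u + 1)) +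
      2 * Real.exp (-(π * y) * u ^ 2 + π * y + ‖2 * π * I * s * ρ‖ * (u + 1)))
    (by simpa using (tendsto_exp_neg_sq_add (by positivity : 0 < π * x) _ _).add
          (tendsto_exp_neg_sq_add (by positivity : 0 < π * y) _ _)) (R₀ := 1)
    (by
      intro u v hu hv
      rw [hΦ_of_ne]
      · exact (norm_sub_le _ _).trans (add_le_add (norm_gaussian_div_le hx _ hu hv)
          (norm_gaussian_div_le hy _ hu hv))
      · intro h
        have := congrArg Complex.re h
        simp at this
        rw [this] at hu
        norm_num at hu)
    (by simpa using hint 1 (by norm_num)) (by simpa using hint (-1) (by norm_num))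
  have e1 := hval 1 (by norm_num)
  have e2 := hval (-1) (by norm_num)
  simp only [one_mul, neg_mul, neg_neg] at e1 e2
  rw [e1, e2] at key
  simp only [mordellJump, one_mul, neg_mul]
  linear_combination -key

theorem mordellJump_eq {x : ℝ} (hx : 0 < x) (t : ℝ) :
    mordellJump x t = -I * Complex.exp (π * I / 4) := by
  rw [mordellJump_congr hx one_pos t (1 / 2), mordellJump]
  have h := mordell_add_mordell_add_one one_pos 0
  have e1 : Complex.exp (π * I * (1 : ℝ) / 4 + (-1 : ℝ) * (π * I * (1 / 2 : ℝ))) =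
      -I * Complex.exp (π * I / 4) := by
    rw [show π * I * (1 : ℝ) / 4 + (-1 : ℝ) * (π * I * (1 / 2 : ℝ)) =
      -(π / 2 * I) + π * I / 4 by push_cast; ring, Complex.exp_add, Complex.exp_neg,
      exp_pi_div_two_mul_I, inv_I]
  have e2 : Complex.exp (π * I * (1 : ℝ) / 4 + (1 : ℝ) * (π * I * (1 / 2 : ℝ))) =
      I * Complex.exp (π * I / 4) := by
    rw [show π * I * (1 : ℝ) / 4 + (1 : ℝ) * (π * I * (1 / 2 : ℝ)) = π / 2 * I + π * I / 4 by
      push_cast; ring, Complex.exp_add, exp_pi_div_two_mul_I]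
  rw [e1, e2]
  norm_num at h ⊢
  linear_combination (-I * Complex.exp (π * I / 4)) * h

/-- The theta sum over `0 ≤ n < N`. -/
noncomputable def thetaSum (x t : ℝ) (N : ℕ) : ℂ :=
  ∑ n ∈ range N, Complex.exp (π * I * n ^ 2 * x + 2 * π * I * n * t)

theorem thetaSum_sub_int (x t : ℝ) (k : ℤ) (N : ℕ) :
    thetaSum x (t - k) N = thetaSum x t N := by
  refine sum_congr rfl fun n _ => ?_
  rw [Complex.exp_eq_exp_iff_exists_int]
  refine ⟨-(n * k), ?_⟩
  push_cast
  ring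

/-- The boundary term of `thetaSum` at the half-integer `c`. -/
noncomputable def thetaEdge (x t c : ℝ) : ℂ :=
  Complex.exp (π * I * x * c ^ 2 + 2 * π * I * t * c) * mordell x (t + x * c)

theorem norm_thetaEdge (x t c : ℝ) : ‖thetaEdge x t c‖ = ‖mordell x (t + x * c)‖ := by
  rw [thetaEdge, norm_mul, show π * I * x * c ^ 2 + 2 * π * I * t * c =
    ((π * x * c ^ 2 + 2 * π * t * c : ℝ) : ℂ) * I by push_cast; ring, norm_exp_ofReal_mul_I, one_mul]

theorem thetaEdge_sub_thetaEdge {x : ℝ} (hx : 0 < x) (t n : ℝ) :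
    ρ * (thetaEdge x t (n - 1 / 2) - thetaEdge x t (n + 1 / 2)) =
      Complex.exp (π * I * n ^ 2 * x + 2 * π * I * n * t) := by
  have h := mordellJump_eq hx (t + n * x)
  have e : ∀ σ : ℝ, σ ^ 2 = 1 → thetaEdge x t (n + σ * (1 / 2)) =
      Complex.exp (π * I * n ^ 2 * x + 2 * π * I * n * t) *
        (Complex.exp (π * I * x / 4 + σ * (π * I * (t + n * x : ℝ))) *
          mordell x (t + n * x + σ * (x / 2))) := by
    intro σ hσ
    have hσ' : (σ : ℂ) ^ 2 = 1 := by exact_mod_cast hσ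
    rw [thetaEdge, ← mul_assoc, ← Complex.exp_add]
    congr 1
    · congr 1
      push_cast
      linear_combination (π * I * x / 4) * hσ'
    · congr 1
      ring
  have e1 := e (-1) (by norm_num)
  have e2 := e 1 (by norm_num)
  rw [neg_one_mul, ← sub_eq_add_neg] at e1
  rw [one_mul] at e2
  rw [e1, e2]
  rw [mordellJump] at h
  have hρ : ρ = Complex.exp (π * I / 4) := rfl
  rw [← hρ] at h
  linear_combination (ρ * Complex.exp (π * I * n ^ 2 * x + 2 * π * I * n * t)) * h -
    Complex.exp (π * I * n ^ 2 * x + 2 * π * I * n * t) * (I * rho_sq + I_sq)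

theorem thetaSum_eq {x : ℝ} (hx : 0 < x) (t : ℝ) (N : ℕ) :
    thetaSum x t N = ρ * (thetaEdge x t (-1 / 2) - thetaEdge x t (N - 1 / 2)) := by
  induction N with
  | zero => simp [thetaSum, neg_div]
  | succ N ih =>
    have h := thetaEdge_sub_thetaEdge hx t N
    rw [thetaSum, sum_range_succ, ← thetaSum, ih]
    rw [show ((N + 1 : ℕ) : ℝ) - 1 / 2 = N + 1 / 2 by push_cast; ring]
    simp only [ofReal_natCast] at h
    rw [← h]
    ring

theorem mordell_add_nat {x : ℝ} (hx : 0 < x) (β : ℝ) (M : ℕ) :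
    (-1) ^ M * mordell x (β + M) = mordell x β -
      (1 / √x : ℝ) * ∑ m ∈ range M, (-1) ^ m * Complex.exp (-(π * I * (β + m) ^ 2 / x)) := by
  induction M with
  | zero => simp
  | succ M ih =>
    have h := mordell_add_mordell_add_one hx (β + M)
    rw [sum_range_succ, Nat.cast_succ, ← add_assoc, pow_succ]
    push_cast at h ⊢
    push_cast at ih
    linear_combination ih - (-1) ^ M * h

theorem norm_sum_dual {x : ℝ} (hx : 0 < x) (β : ℝ) (M : ℕ) :
    ‖∑ m ∈ range M, (-1 : ℂ) ^ m * Complex.exp (-(π * I * (β + m) ^ 2 / x))‖ =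
      ‖thetaSum (Int.fract (1 / x)) (β / x + 1 / 2 + ⌊1 / x⌋ / 2) M‖ := by
  have hx' : (x : ℂ) ≠ 0 := ofReal_ne_zero.2 hx.ne'
  have hy : ((Int.fract (1 / x) : ℝ) : ℂ) = 1 / x - ⌊1 / x⌋ := by
    rw [Int.fract]; push_cast; rfl
  have h : starRingEnd ℂ (∑ m ∈ range M, (-1) ^ m * Complex.exp (-(π * I * (β + m) ^ 2 / x))) =
      Complex.exp ((π * β ^ 2 / x : ℝ) * I) *
        thetaSum (Int.fract (1 / x)) (β / x + 1 / 2 + ⌊1 / x⌋ / 2) M := by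
    rw [map_sum, thetaSum, mul_sum]
    refine sum_congr rfl fun m _ => ?_
    have hm : (-1 : ℂ) ^ m = Complex.exp (m * (π * I)) := by rw [Complex.exp_nat_mul, exp_pi_mul_I]
    rw [map_mul, map_pow, map_neg, map_one, ← Complex.exp_conj, hm, ← Complex.exp_add,
      ← Complex.exp_add, Complex.exp_eq_exp_iff_exists_int]
    refine ⟨⌊1 / x⌋ * (m.choose 2 : ℕ), ?_⟩
    simp only [map_neg, map_div₀, map_mul, map_pow, map_add, conj_ofReal, conj_I, map_natCast, hy]
    push_cast
    rw [Nat.cast_choose_two]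
    field_simp
    ring
  rw [← RCLike.norm_conj, h, norm_mul, norm_exp_ofReal_mul_I, one_mul]

theorem norm_thetaSum_le_step {x : ℝ} (hx : 0 < x) (t : ℝ) (N : ℕ) : ∃ (s : ℝ) (M : ℕ),
    (M : ℝ) ≤ N * x + 1 ∧
      ‖thetaSum x t N‖ ≤ 1 / √x * (8 + ‖thetaSum (Int.fract (1 / x)) s M‖) := by
  set β := Int.fract (t - x / 2) with hβ
  have hβ0 : 0 ≤ β := Int.fract_nonneg _
  have hβ1 : β < 1 := Int.fract_lt_one _
  have hNx : 0 ≤ N * x := by positivity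
  set γ := β + N * x with hγ
  have hM : (⌊γ⌋₊ : ℝ) ≤ γ := Nat.floor_le (by linarith)
  have hM' : γ < ⌊γ⌋₊ + 1 := Nat.lt_floor_add_one γ
  refine ⟨(γ - ⌊γ⌋₊) / x + 1 / 2 + ⌊1 / x⌋ / 2, ⌊γ⌋₊, by linarith, ?_⟩
  rw [← thetaSum_sub_int x t ⌊t - x / 2⌋, thetaSum_eq hx, norm_mul, norm_rho, one_mul]
  refine (norm_sub_le _ _).trans ?_
  rw [norm_thetaEdge, norm_thetaEdge, ← norm_sum_dual hx]
  have e1 : t - ⌊t - x / 2⌋ + x * (-1 / 2) = β := by rw [hβ, Int.fract]; ring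
  have e2 : t - ⌊t - x / 2⌋ + x * (N - 1 / 2) = γ - ⌊γ⌋₊ + ⌊γ⌋₊ := by
    rw [hγ, hβ, Int.fract]; ring
  rw [e1, e2]
  have h1 := norm_mordell_le hx hβ0 hβ1.le
  have h2 := norm_mordell_le hx (sub_nonneg.2 hM) (by linarith : γ - ⌊γ⌋₊ ≤ 1)
  have h3 := congrArg norm (mordell_add_nat hx (γ - ⌊γ⌋₊) ⌊γ⌋₊)
  rw [norm_mul, norm_pow, norm_neg, norm_one, one_pow, one_mul] at h3
  rw [h3]
  refine (add_le_add h1 ((norm_sub_le _ _).trans (add_le_add_left h2 _))).trans (le_of_eq ?_)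
  rw [norm_mul, norm_real, Real.norm_eq_abs, abs_of_nonneg (by positivity)]
  push_cast
  ring

/-- The orbit of `x` under the Gauss map. -/
noncomputable def gaussOrbit (x : ℝ) (n : ℕ) : ℝ := (fun y : ℝ => Int.fract (1 / y))^[n] x

theorem gaussOrbit_succ (x : ℝ) (n : ℕ) :
    gaussOrbit x (n + 1) = Int.fract (1 / gaussOrbit x n) := by
  rw [gaussOrbit, Function.iterate_succ_apply', ← gaussOrbit]

theorem gaussOrbit_succ' (x : ℝ) (n : ℕ) :
    gaussOrbit x (n + 1) = gaussOrbit (Int.fract (1 / x)) n := by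
  rw [gaussOrbit, Function.iterate_succ_apply, ← gaussOrbit]

theorem irrational_fract_one_div {x : ℝ} (hx : Irrational x) : Irrational (Int.fract (1 / x)) := by
  rw [Int.fract, one_div]
  exact hx.inv.sub_intCast _

theorem fract_one_div_mem {x : ℝ} (hx : Irrational x) : Int.fract (1 / x) ∈ Set.Ioo (0 : ℝ) 1 :=
  ⟨(Int.fract_nonneg _).lt_of_ne (irrational_fract_one_div hx).ne_zero.symm, Int.fract_lt_one _⟩

theorem irrational_gaussOrbit {x : ℝ} (hx : Irrational x) (n : ℕ) :
    Irrational (gaussOrbit x n) := by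
  induction n with
  | zero => exact hx
  | succ n ih => rw [gaussOrbit_succ]; exact irrational_fract_one_div ih

theorem gaussOrbit_mem {x : ℝ} (hx : Irrational x) (h : x ∈ Set.Ioo (0 : ℝ) 1) (n : ℕ) :
    gaussOrbit x n ∈ Set.Ioo (0 : ℝ) 1 := by
  cases n with
  | zero => exact h
  | succ n => rw [gaussOrbit_succ]; exact fract_one_div_mem (irrational_gaussOrbit hx n)

/-- The product of the first `r` points of the Gauss orbit. -/
noncomputable def orbitProd (x : ℝ) (r : ℕ) : ℝ := ∏ j ∈ range r, gaussOrbit x j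

theorem orbitProd_zero (x : ℝ) : orbitProd x 0 = 1 := prod_range_zero _

theorem orbitProd_succ (x : ℝ) (r : ℕ) : orbitProd x (r + 1) = orbitProd x r * gaussOrbit x r :=
  prod_range_succ _ _

theorem orbitProd_succ' (x : ℝ) (r : ℕ) :
    orbitProd x (r + 1) = orbitProd (Int.fract (1 / x)) r * x := by
  rw [orbitProd, prod_range_succ', orbitProd]
  simp_rw [gaussOrbit_succ']
  rfl

theorem orbitProd_pos {x : ℝ} (hx : Irrational x) (h : x ∈ Set.Ioo (0 : ℝ) 1) (r : ℕ) :
    0 < orbitProd x r := prod_pos fun j _ => (gaussOrbit_mem hx h j).1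

theorem orbitProd_le_one {x : ℝ} (hx : Irrational x) (h : x ∈ Set.Ioo (0 : ℝ) 1) (r : ℕ) :
    orbitProd x r ≤ 1 :=
  prod_le_one (fun j _ => (gaussOrbit_mem hx h j).1.le) fun j _ => (gaussOrbit_mem hx h j).2.le

theorem mul_fract_one_div_le {x : ℝ} (h : x ∈ Set.Ioo (0 : ℝ) 1) :
    x * Int.fract (1 / x) ≤ 1 / 2 := by
  have h1 : (1 : ℝ) ≤ ⌊1 / x⌋ := by
    exact_mod_cast Int.le_floor.2 (by rw [Int.cast_one, le_div_iff₀ h.1]; linarith [h.2])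
  have h2 := Int.fract_lt_one (1 / x)
  have h3 : x * (⌊1 / x⌋ + Int.fract (1 / x)) = 1 := by
    rw [Int.floor_add_fract, mul_one_div_cancel h.1.ne']
  nlinarith [h.1]

/-- The error accumulated after `r` applications of the approximate functional equation. -/
noncomputable def orbitError (x : ℝ) (r : ℕ) : ℝ := ∑ j ∈ range r, 1 / √(orbitProd x (j + 1))

theorem orbitError_succ' {x : ℝ} (hx : 0 ≤ x) (r : ℕ) :
    orbitError x (r + 1) = 1 / √x * (orbitError (Int.fract (1 / x)) r + 1) := by
  have h : ∀ j, 1 / √(orbitProd x (j + 1)) = 1 / √x * (1 / √(orbitProd (Int.fract (1 / x)) j)) := by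
    intro j
    rw [orbitProd_succ', Real.sqrt_mul' _ hx, one_div_mul_one_div, mul_comm]
  rw [orbitError, sum_range_succ']
  simp_rw [h]
  rw [← mul_sum, ← orbitError, orbitProd_zero, Real.sqrt_one]
  ring

theorem norm_thetaSum_le_orbit {x : ℝ} (hx : Irrational x) (h : x ∈ Set.Ioo (0 : ℝ) 1) (r : ℕ)
    (t : ℝ) (N : ℕ) : ‖thetaSum x t N‖ ≤ N * √(orbitProd x r) + 9 * orbitError x r := by
  induction r generalizing x t N with
  | zero =>
    rw [orbitProd_zero, Real.sqrt_one, orbitError, sum_range_zero, mul_zero, add_zero, mul_one]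
    refine (norm_sum_le _ _).trans (le_of_eq ?_)
    rw [sum_congr rfl (g := fun _ => (1 : ℝ)), sum_const, card_range, nsmul_one]
    intro n _
    rw [show π * I * n ^ 2 * x + 2 * π * I * n * t =
      ((π * n ^ 2 * x + 2 * π * n * t : ℝ) : ℂ) * I by push_cast; ring, norm_exp_ofReal_mul_I]
  | succ r ih =>
    obtain ⟨s, M, hM, hle⟩ := norm_thetaSum_le_step h.1 t N
    have hy := irrational_fract_one_div hx
    have hy' := fract_one_div_mem hx
    have hp := Real.sqrt_le_one.2 (orbitProd_le_one hy hy' r)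
    have ih' := ih hy hy' s M
    have hsx : 0 < √x := Real.sqrt_pos.2 h.1
    have hxx : √x * √x = x := Real.mul_self_sqrt h.1.le
    refine hle.trans ?_
    rw [orbitProd_succ', orbitError_succ' h.1.le, Real.sqrt_mul' _ h.1.le]
    set P := √(orbitProd (Int.fract (1 / x)) r)
    set E := orbitError (Int.fract (1 / x)) r
    have hP : 0 ≤ P := Real.sqrt_nonneg _
    have hbound : 8 + ‖thetaSum (Int.fract (1 / x)) s M‖ ≤ N * x * P + 9 * (E + 1) := by
      linarith [mul_le_mul_of_nonneg_right hM hP]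
    calc _ ≤ 1 / √x * (N * x * P + 9 * (E + 1)) :=
          mul_le_mul_of_nonneg_left hbound (by positivity)
      _ = _ := by
          nth_rw 2 [← hxx]
          field_simp

theorem one_div_sqrt_orbitProd_mono {x : ℝ} (hx : Irrational x) (h : x ∈ Set.Ioo (0 : ℝ) 1)
    (r : ℕ) : 1 / √(orbitProd x r) ≤ 1 / √(orbitProd x (r + 1)) := by
  refine one_div_le_one_div_of_le (Real.sqrt_pos.2 (orbitProd_pos hx h _)) (Real.sqrt_le_sqrt ?_)
  rw [orbitProd_succ]
  exact mul_le_of_le_one_right (orbitProd_pos hx h r).le (gaussOrbit_mem hx h r).2.le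

theorem one_div_sqrt_orbitProd_growth {x : ℝ} (hx : Irrational x) (h : x ∈ Set.Ioo (0 : ℝ) 1)
    (r : ℕ) : 4 / 3 * (1 / √(orbitProd x r)) ≤ 1 / √(orbitProd x (r + 2)) := by
  have h1 := mul_fract_one_div_le (gaussOrbit_mem hx h r)
  rw [← gaussOrbit_succ] at h1
  have hp := orbitProd_pos hx h r
  have h2 : √(orbitProd x (r + 2)) ≤ 3 / 4 * √(orbitProd x r) := by
    rw [Real.sqrt_le_left (by positivity), mul_pow, Real.sq_sqrt hp.le, orbitProd_succ,
      orbitProd_succ, mul_assoc]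
    nlinarith
  have hq := Real.sqrt_pos.2 (orbitProd_pos hx h (r + 2))
  have hp' := Real.sqrt_pos.2 hp
  rw [mul_one_div, div_le_div_iff₀ hp' hq]
  linarith

theorem orbitError_le {x : ℝ} (hx : Irrational x) (h : x ∈ Set.Ioo (0 : ℝ) 1) (r : ℕ) :
    orbitError x r ≤ 8 * (1 / √(orbitProd x r)) := by
  have h1 : ∀ r, orbitError x (r + 1) ≤
      4 * (1 / √(orbitProd x (r + 1))) + 4 * (1 / √(orbitProd x r)) := by
    intro r
    induction r with
    | zero =>
      rw [orbitError, sum_range_one]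
      have : 0 ≤ 1 / √(orbitProd x 0) := by positivity
      have : 0 ≤ 1 / √(orbitProd x (0 + 1)) := by positivity
      linarith
    | succ r ih =>
      have := one_div_sqrt_orbitProd_growth hx h r
      rw [orbitError, sum_range_succ, ← orbitError]
      linarith
  cases r with
  | zero => simp [orbitError]
  | succ r => linarith [h1 r, one_div_sqrt_orbitProd_mono hx h r]

open GenContFract in
theorem stream_eq_gaussOrbit {x : ℝ} (hx : Irrational x) (h : x ∈ Set.Ioo (0 : ℝ) 1) (n : ℕ) :
    ∃ p, IntFractPair.stream x n = some p ∧ p.fr = gaussOrbit x n := by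
  induction n with
  | zero =>
    exact ⟨_, IntFractPair.stream_zero x, Int.fract_eq_self.2 ⟨h.1.le, h.2⟩⟩
  | succ n ih =>
    obtain ⟨p, hp, hfr⟩ := ih
    refine ⟨_, IntFractPair.stream_succ_of_some hp ?_, ?_⟩
    · rw [hfr]; exact (gaussOrbit_mem hx h n).1.ne'
    · rw [gaussOrbit_succ, ← hfr, one_div]; rfl

open GenContFract in
theorem inv_orbitProd_eq {x : ℝ} (hx : Irrational x) (h : x ∈ Set.Ioo (0 : ℝ) 1) (r : ℕ) :
    1 / orbitProd x r = ((GenContFract.of x).contsAux (r + 1)).b +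
      gaussOrbit x r * ((GenContFract.of x).contsAux r).b := by
  induction r with
  | zero => simp [orbitProd_zero]
  | succ r ih =>
    obtain ⟨p, hp, hfr⟩ := stream_eq_gaussOrbit hx h r
    have hpos := (gaussOrbit_mem hx h r).1
    have hs := get?_of_eq_some_of_get?_intFractPair_stream_fr_ne_zero hp (by rw [hfr]; exact hpos.ne')
    have hb : ((GenContFract.of x).contsAux (r + 2)).b =
        ⌊(gaussOrbit x r)⁻¹⌋ * ((GenContFract.of x).contsAux (r + 1)).b +
          ((GenContFract.of x).contsAux r).b := by
      rw [contsAux_recurrence hs rfl rfl, ← hfr]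
      exact congrArg _ (one_mul _)
    rw [hb, orbitProd_succ, ← one_div_mul_one_div, ih, gaussOrbit_succ, Int.fract, one_div]
    field_simp
    ring

theorem Qden_le_and_le {x : ℝ} (hx : Irrational x) (h : x ∈ Set.Ioo (0 : ℝ) 1) (r : ℕ) :
    Qden x r ≤ 1 / orbitProd x r ∧ 1 / orbitProd x r ≤ 2 * Qden x r := by
  have hQ : Qden x r = ((GenContFract.of x).contsAux (r + 1)).b := by
    rw [Qden, GenContFract.den_eq_conts_b, GenContFract.nth_cont_eq_succ_nth_contAux]
  have h0 : 0 ≤ ((GenContFract.of x).contsAux r).b := GenContFract.zero_le_of_contsAux_b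
  have h1 : ((GenContFract.of x).contsAux r).b ≤ ((GenContFract.of x).contsAux (r + 1)).b := by
    cases r with
    | zero => simp
    | succ r =>
      have := GenContFract.of_den_mono (v := x) (n := r)
      rwa [GenContFract.den_eq_conts_b, GenContFract.nth_cont_eq_succ_nth_contAux,
        GenContFract.den_eq_conts_b, GenContFract.nth_cont_eq_succ_nth_contAux] at this
  have hm := gaussOrbit_mem hx h r
  rw [inv_orbitProd_eq hx h, hQ]
  constructor <;> nlinarith [hm.1, hm.2]

theorem norm_sum_Icc_eq (x t : ℝ) (N : ℕ) :
    ‖∑ k ∈ Finset.Icc 1 N, Complex.exp (Real.pi * Complex.I * (k : ℂ) ^ 2 * (x : ℂ)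
      + 2 * Real.pi * Complex.I * (k : ℂ) * (t : ℂ))‖ = ‖thetaSum x (t + x) N‖ := by
  have h : ∑ k ∈ Finset.Icc 1 N, Complex.exp (Real.pi * Complex.I * (k : ℂ) ^ 2 * (x : ℂ)
      + 2 * Real.pi * Complex.I * (k : ℂ) * (t : ℂ)) =
      Complex.exp ((π * x + 2 * π * t : ℝ) * I) * thetaSum x (t + x) N := by
    rw [← Finset.Ico_add_one_right_eq_Icc, sum_Ico_eq_sum_range, thetaSum, mul_sum]
    refine sum_congr rfl fun n _ => ?_
    rw [← Complex.exp_add]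
    congr 1
    push_cast
    ring
  rw [h, norm_mul, norm_exp_ofReal_mul_I, one_mul]

/-- the Hardy–Littlewood bound for theta sums. -/
theorem stmt2 :
    ∃ C : ℝ, 0 < C ∧ ∀ x : ℝ, x ∈ Set.Ioo (0 : ℝ) 1 → Irrational x → ∀ t : ℝ,
      ∀ N : ℕ, 1 ≤ N → ∀ r : ℕ,
      ‖∑ k ∈ Finset.Icc 1 N, Complex.exp (Real.pi * Complex.I * (k : ℂ) ^ 2 * (x : ℂ)
          + 2 * Real.pi * Complex.I * (k : ℂ) * (t : ℂ))‖
        ≤ C * ((N : ℝ) / Real.sqrt (Qden x r) + Real.sqrt (Qden x r)) := by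
  refine ⟨144, by norm_num, fun x h hx t N _ r => ?_⟩
  rw [norm_sum_Icc_eq]
  obtain ⟨h1, h2⟩ := Qden_le_and_le hx h r
  have hp := orbitProd_pos hx h r
  have hQ : 0 < Qden x r := by linarith [one_div_pos.2 hp]
  have e1 : √(orbitProd x r) ≤ 1 / √(Qden x r) := by
    rw [one_div, ← Real.sqrt_inv, ← one_div]
    exact Real.sqrt_le_sqrt ((le_one_div hQ hp).1 h1)
  have e2 : 1 / √(orbitProd x r) ≤ 2 * √(Qden x r) := by
    rw [one_div, ← Real.sqrt_inv, ← one_div, Real.sqrt_le_left (by positivity), mul_pow,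
      Real.sq_sqrt hQ.le]
    linarith
  have e3 : N * √(orbitProd x r) ≤ N / √(Qden x r) := by
    rw [div_eq_mul_one_div]
    gcongr
  have e4 : 0 ≤ N / √(Qden x r) := by positivity
  linarith [norm_thetaSum_le_orbit hx h r (t + x) N, orbitError_le hx h r]
end
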